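/- arXiv:1912.06241 — 3 statements merged into one kernel-verified Lean document; each statement's English description precedes it below -/
import Mathlib

section
/- Let N ≥ 4 be even and n = N−1. There exists a nonzero polynomial p in the variables (ω_1,…,ω_n, a, entries of an n×n matrix R) such that for every ω ∈ ℂ^n, a ∈ ℂ∖{0}, and invertible complex n×n matrix R with p(ω, a, R) ≠ 0, setting c =Able Rω: the number of solutions x ∈ (ℂ∖{0})^n of the algebraic Kuramoto system for C_N with uniform coupling and parameters (ω, a) equals the sum, over all sign vectors λ ∈ {−1,1}^N with λ_1 + ⋯ + λ_N = 0, of the number of solutions x ∈ (ℂ∖{0})^n of the facet subsystem determined by (c, a, R, V(λ)); moreover every one of these solutions is an isolated nonsingular zero. -/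
open Complex

noncomputable section

/-- Extended variables for the cycle `C_N`: `X 0 = 1`, `X j = x_j` for `j = 1, …, N-1`,
indices taken modulo `N`. -/
def kuraX (N : ℕ) (hN : 0 < N) (x : Fin (N - 1) → ℂ) : ℕ → ℂ := fun j =>
  if hr : j % N = 0 then 1
  else x ⟨j % N - 1, Nat.sub_lt_sub_right (Nat.pos_of_ne_zero hr) (Nat.mod_lt j hN)⟩

/-- The `i`-th equation of the algebraic Kuramoto system for `C_N` with uniform coupling. -/
def kuraF (N : ℕ) (hN : 0 < N) (ω : Fin (N - 1) → ℂ) (a : ℂ) (i : Fin (N - 1))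
    (x : Fin (N - 1) → ℂ) : ℂ :=
  ω i - a * (kuraX N hN x (i.val + 1) / kuraX N hN x i.val
    - kuraX N hN x i.val / kuraX N hN x (i.val + 1)
    + kuraX N hN x (i.val + 1) / kuraX N hN x (i.val + 2)
    - kuraX N hN x (i.val + 2) / kuraX N hN x (i.val + 1))

/-- The Jacobian matrix `(∂f_i/∂x_j)` of the Kuramoto system at `x`. -/
def kuraJac (N : ℕ) (hN : 0 < N) (ω : Fin (N - 1) → ℂ) (a : ℂ) (x : Fin (N - 1) → ℂ) :
    Matrix (Fin (N - 1)) (Fin (N - 1)) ℂ :=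
  Matrix.of fun i j => deriv (fun t => kuraF N hN ω a i (Function.update x j t)) (x j)

/-- The monomial `x^v = ∏_j x_j^{v_j}` (integer exponents). -/
def mpow {n : ℕ} (x : Fin n → ℂ) (v : Fin n → ℤ) : ℂ := ∏ j, x j ^ v j

/-- The facet matrix `V(λ)`: its `k`-th column (`k = 1, …, N`) is `λ_k (e_{k-1} − e_k)`,
with `e_0 = e_N = 0`.  Rows are indexed by `Fin (N-1)` (row `r` is coordinate `r+1`),
columns by `Fin N` (column `k` is column `k+1`). -/
def facetV (N : ℕ) (lam : Fin N → ℤ) : Matrix (Fin (N - 1)) (Fin N) ℤ :=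
  Matrix.of fun r k =>
    lam k * ((if (r : ℕ) + 1 = (k : ℕ) then 1 else 0) - (if (r : ℕ) = (k : ℕ) then 1 else 0))

/-- The set of solutions `x ∈ (ℂ∖{0})^{N-1}` of the facet subsystem
`c_i = a ∑_{k=1}^N (RV)_{ik} x^{v_k}`, `i = 1, …, N-1`, determined by `(c, a, R, V(λ))`. -/
def facetSol (N : ℕ) (c : Fin (N - 1) → ℂ) (a : ℂ)
    (R : Matrix (Fin (N - 1)) (Fin (N - 1)) ℂ) (lam : Fin N → ℤ) :
    Set (Fin (N - 1) → ℂ) :=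
  {x | (∀ j, x j ≠ 0) ∧
    ∀ i, c i = a * ∑ k, (∑ r, R i r * (facetV N lam r k : ℂ)) *
      mpow x (fun r => facetV N lam r k)}

/-- The sign vector `λ ∈ {−1, 1}^N` encoded by a boolean vector. -/
def signVec {N : ℕ} (s : Fin N → Bool) : Fin N → ℤ := fun k => if s k then 1 else -1

section Auxiliary

open Filter Topology

/-! ### Images of hypersurfaces under polynomial maps -/

/-- A polynomial map from affine space to affine space of the same dimension sends every
hypersurface into a hypersurface. -/
lemma MvPolynomial.exists_eval_eq_zero_of_hypersurface {σ : Type} [Fintype σ]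
    (f : σ → MvPolynomial σ ℂ) (J : MvPolynomial σ ℂ) (hJ : J ≠ 0) :
    ∃ q : MvPolynomial σ ℂ, q ≠ 0 ∧ ∀ x : σ → ℂ, MvPolynomial.eval x J = 0 →
      MvPolynomial.eval (fun i => MvPolynomial.eval x (f i)) q = 0 := by
  have hdep : ¬ AlgebraicIndependent ℂ (fun o : Option σ => o.elim J f) := by
    intro h
    have h1 := h.cardinalMk_le_trdeg
    rw [MvPolynomial.trdeg_of_isDomain] at h1
    simp only [Cardinal.mk_fintype, Fintype.card_option, Cardinal.lift_natCast] at h1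
    have h2 := Nat.cast_le.mp h1
    omega
  rw [algebraicIndependent_iff] at hdep
  push Not at hdep
  obtain ⟨Q, hQ, hQ0⟩ := hdep
  set P := MvPolynomial.optionEquivLeft ℂ σ Q with hP
  have hP0 : P ≠ 0 := by simpa [hP] using hQ0
  have hPQ : Polynomial.eval₂ (MvPolynomial.aeval f : MvPolynomial σ ℂ →ₐ[ℂ] _).toRingHom J P
      = 0 := by
    rw [← hQ, hP]
    clear hQ hQ0 hP hP0 P
    induction Q using MvPolynomial.induction_on with
    | C a => simp
    | add p q hp hq => simp_all
    | mul_X p o hp => cases o <;> simp_all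
  obtain ⟨P', hP', hnd⟩ := P.exists_eq_pow_rootMultiplicity_mul_and_not_dvd hP0 0
  rw [map_zero, sub_zero] at hP' hnd
  refine ⟨P'.coeff 0, fun h => hnd (Polynomial.X_dvd_iff.mpr h), fun x hx => ?_⟩
  rw [hP', Polynomial.eval₂_mul, Polynomial.eval₂_pow, Polynomial.eval₂_X, mul_eq_zero] at hPQ
  have h0 := hPQ.resolve_left (pow_ne_zero _ hJ)
  have h1 := congrArg (MvPolynomial.eval x) h0
  rw [Polynomial.hom_eval₂, hx, map_zero, Polynomial.eval₂_at_zero] at h1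
  rw [← h1]
  simp only [AlgHom.toRingHom_eq_coe, RingHom.coe_comp, RingHom.coe_coe, Function.comp_apply]
  rw [MvPolynomial.aeval_def, ← MvPolynomial.eval₂_id, MvPolynomial.hom_eval₂]
  congr 1
  ext
  · simp

/-! ### Laurent functions on the torus -/

/-- Functions on the torus that become polynomial after multiplication by a power of the
product of all coordinates. -/
def IsLaurent {n : ℕ} (g : (Fin n → ℂ) → ℂ) : Prop :=
  ∃ (e : ℕ) (P : MvPolynomial (Fin n) ℂ), ∀ x : Fin n → ℂ, (∀ j, x j ≠ 0) →
    (∏ j, x j) ^ e * g x = MvPolynomial.eval x P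

namespace IsLaurent

variable {n : ℕ} {g h : (Fin n → ℂ) → ℂ}

lemma const (c : ℂ) : IsLaurent (fun _ : Fin n → ℂ => c) :=
  ⟨0, MvPolynomial.C c, by simp⟩

lemma coord (j : Fin n) : IsLaurent (fun x : Fin n → ℂ => x j) :=
  ⟨0, MvPolynomial.X j, by simp⟩

lemma inv_coord (j : Fin n) : IsLaurent (fun x : Fin n → ℂ => (x j)⁻¹) := by
  refine ⟨1, ∏ i ∈ Finset.univ.erase j, MvPolynomial.X i, fun x hx => ?_⟩
  rw [← Finset.mul_prod_erase _ _ (Finset.mem_univ j)]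
  have := hx j
  simp only [pow_one, map_prod, MvPolynomial.eval_X]
  field_simp

lemma mul (hg : IsLaurent g) (hh : IsLaurent h) : IsLaurent (fun x => g x * h x) := by
  obtain ⟨e, P, hP⟩ := hg
  obtain ⟨d, Q, hQ⟩ := hh
  refine ⟨e + d, P * Q, fun x hx => ?_⟩
  rw [map_mul, ← hP x hx, ← hQ x hx]
  ring

lemma add (hg : IsLaurent g) (hh : IsLaurent h) : IsLaurent (fun x => g x + h x) := by
  obtain ⟨e, P, hP⟩ := hg
  obtain ⟨d, Q, hQ⟩ := hh
  refine ⟨e + d, (∏ j, MvPolynomial.X j) ^ d * P + (∏ j, MvPolynomial.X j) ^ e * Q,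
    fun x hx => ?_⟩
  simp only [map_add, map_mul, ← hP x hx, ← hQ x hx, map_pow, map_prod, MvPolynomial.eval_X]
  ring

lemma sub (hg : IsLaurent g) (hh : IsLaurent h) : IsLaurent (fun x => g x - h x) := by
  simpa [sub_eq_add_neg] using hg.add ((const (-1)).mul hh)

lemma sum {ι : Type*} (s : Finset ι) {f : ι → (Fin n → ℂ) → ℂ} (hf : ∀ i ∈ s, IsLaurent (f i)) :
    IsLaurent (fun x => ∑ i ∈ s, f i x) := by
  classical
  induction s using Finset.induction_on with
  | empty => simpa using const 0
  | insert a s ha ih =>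
    simp only [Finset.sum_insert ha]
    exact (hf a (by simp)).add (ih fun i hi => hf i (by simp [hi]))

lemma prod {ι : Type*} (s : Finset ι) {f : ι → (Fin n → ℂ) → ℂ}
    (hf : ∀ i ∈ s, IsLaurent (f i)) : IsLaurent (fun x => ∏ i ∈ s, f i x) := by
  classical
  induction s using Finset.induction_on with
  | empty => simpa using const 1
  | insert a s ha ih =>
    simp only [Finset.prod_insert ha]
    exact (hf a (by simp)).mul (ih fun i hi => hf i (by simp [hi]))

lemma exists_of_le (hg : IsLaurent g) :
    ∃ e₀ : ℕ, ∀ e, e₀ ≤ e → ∃ P : MvPolynomial (Fin n) ℂ, ∀ x : Fin n → ℂ, (∀ j, x j ≠ 0) →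
      (∏ j, x j) ^ e * g x = MvPolynomial.eval x P := by
  obtain ⟨e, P, hP⟩ := hg
  refine ⟨e, fun d hd => ⟨(∏ j, MvPolynomial.X j) ^ (d - e) * P, fun x hx => ?_⟩⟩
  simp only [map_mul, ← hP x hx, map_pow, map_prod, MvPolynomial.eval_X]
  rw [← mul_assoc, ← pow_add, Nat.sub_add_cancel hd]

end IsLaurent

/-! ### Generic properties of the parameters -/

/-- A property of `(ω, a)` holds generically if it holds off a hypersurface, for `a ≠ 0`. -/
def Generically (n : ℕ) (P : (Fin n → ℂ) → ℂ → Prop) : Prop :=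
  ∃ q : MvPolynomial (Fin n ⊕ Unit) ℂ, q ≠ 0 ∧ ∀ (ω : Fin n → ℂ) (a : ℂ), a ≠ 0 →
    MvPolynomial.eval (Sum.elim ω (fun _ => a)) q ≠ 0 → P ω a

namespace Generically

variable {n : ℕ} {P Q : (Fin n → ℂ) → ℂ → Prop}

lemma and (hP : Generically n P) (hQ : Generically n Q) :
    Generically n (fun ω a => P ω a ∧ Q ω a) := by
  obtain ⟨p, hp, hp'⟩ := hP
  obtain ⟨q, hq, hq'⟩ := hQ
  refine ⟨p * q, mul_ne_zero hp hq, fun ω a ha h => ?_⟩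
  rw [map_mul] at h
  exact ⟨hp' ω a ha (left_ne_zero_of_mul h), hq' ω a ha (right_ne_zero_of_mul h)⟩

lemma all {ι : Type*} [Fintype ι] {P : ι → (Fin n → ℂ) → ℂ → Prop}
    (hP : ∀ i, Generically n (P i)) : Generically n (fun ω a => ∀ i, P i ω a) := by
  choose p hp hp' using hP
  refine ⟨∏ i, p i, Finset.prod_ne_zero_iff.mpr fun i _ => hp i, fun ω a ha h i => ?_⟩
  rw [map_prod] at h
  exact hp' i ω a ha (Finset.prod_ne_zero_iff.mp h i (Finset.mem_univ i))

lemma mono (hP : Generically n P) (h : ∀ ω a, a ≠ 0 → P ω a → Q ω a) : Generically n Q := by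
  obtain ⟨p, hp, hp'⟩ := hP
  exact ⟨p, hp, fun ω a ha hq => h ω a ha (hp' ω a ha hq)⟩

lemma of_imp {p : Prop} (h : p → Generically n P) : Generically n (fun ω a => p → P ω a) := by
  by_cases hp : p
  · exact (h hp).mono fun _ _ _ h _ => h
  · exact ⟨1, one_ne_zero, fun _ _ _ _ h => absurd h hp⟩

/-- A linear form in `ω` that does not vanish identically is generically nonzero. -/
lemma linear_ne_zero (c : Fin n → ℂ) (hc : c ≠ 0) :
    Generically n (fun ω _ => ∑ i, c i * ω i ≠ 0) := by
  refine ⟨∑ i, MvPolynomial.C (c i) * MvPolynomial.X (Sum.inl i), fun h => hc ?_,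
    fun ω a _ h => by simpa using h⟩
  funext j
  have := congrArg (MvPolynomial.eval (Sum.elim (Pi.single j 1) (fun _ => (0 : ℂ)))) h
  simpa [Pi.single_apply] using this

/-- Generic parameters avoid the image of a hypersurface of the torus under a family of
Laurent functions scaled by `a`. -/
lemma of_laurent {φ : Fin n → (Fin n → ℂ) → ℂ} {J : (Fin n → ℂ) → ℂ}
    (hφ : ∀ i, IsLaurent (φ i)) (hJ : IsLaurent J) (x₀ : Fin n → ℂ) (hx₀ : ∀ j, x₀ j ≠ 0)
    (hJ₀ : J x₀ ≠ 0) :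
    Generically n (fun ω a => ∀ x : Fin n → ℂ, (∀ j, x j ≠ 0) → (∀ i, ω i = a * φ i x) →
      J x ≠ 0) := by
  choose e he using fun i => (hφ i).exists_of_le
  obtain ⟨d, R, hR⟩ := hJ
  choose P hP using fun i => he i (∑ i, e i) (Finset.single_le_sum (f := e)
    (fun _ _ => Nat.zero_le _) (Finset.mem_univ i))
  set E := ∑ i, e i
  have hR0 : R ≠ 0 := by
    rintro rfl
    have := hR x₀ hx₀
    rw [map_zero, mul_eq_zero] at this
    exact this.elim (pow_ne_zero _ (Finset.prod_ne_zero_iff.mpr fun j _ => hx₀ j)) hJ₀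
  obtain ⟨q, hq, hq'⟩ := MvPolynomial.exists_eval_eq_zero_of_hypersurface
    (Sum.elim (fun i => MvPolynomial.X (Sum.inr ()) * MvPolynomial.rename Sum.inl (P i))
      (fun _ : Unit => MvPolynomial.X (Sum.inr ()) *
        (∏ j : Fin n, MvPolynomial.X (Sum.inl j)) ^ E))
    (MvPolynomial.rename Sum.inl R)
    (by rwa [Ne, ← map_zero (MvPolynomial.rename (Sum.inl : Fin n → Fin n ⊕ Unit)),
      (MvPolynomial.rename_injective _ Sum.inl_injective).eq_iff])
  refine ⟨q, hq, fun ω a ha hqa x hx hω hJx => hqa ?_⟩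
  have hM : (∏ j, x j) ^ E ≠ 0 := pow_ne_zero _ (Finset.prod_ne_zero_iff.mpr fun j _ => hx j)
  rw [← hq' (Sum.elim x (fun _ => a / (∏ j, x j) ^ E))]
  · congr 2
    funext i
    rcases i with i | i
    · simp only [Sum.elim_inl, map_mul, MvPolynomial.eval_X, Sum.elim_inr,
        MvPolynomial.eval_rename, Sum.elim_comp_inl, ← hP i x hx, hω i]
      field_simp
    · simp only [Sum.elim_inr, map_mul, MvPolynomial.eval_X, map_pow, map_prod, Sum.elim_inl]
      field_simp
  · rw [MvPolynomial.eval_rename, Sum.elim_comp_inl, ← hR x hx, hJx, mul_zero]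

end Generically

/-! ### Edge coordinates on the torus -/

section Edge

variable {n : ℕ}

lemma kuraX_zero (x : Fin n → ℂ) : kuraX (n + 1) n.succ_pos x 0 = 1 := by
  simp [kuraX]

lemma kuraX_last (x : Fin n → ℂ) : kuraX (n + 1) n.succ_pos x (n + 1) = 1 := by
  simp [kuraX]

lemma kuraX_succ (x : Fin n → ℂ) (j : Fin n) :
    kuraX (n + 1) n.succ_pos x (j + 1) = x j := by
  have h : ((j : ℕ) + 1) % (n + 1) = j + 1 := Nat.mod_eq_of_lt (by omega)
  simp [kuraX, h]

lemma kuraX_cases {P : ((Fin n → ℂ) → ℂ) → Prop} (h1 : P fun _ => 1)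
    (h : ∀ j : Fin n, P fun x => x j) (k : ℕ) : P fun x => kuraX (n + 1) n.succ_pos x k := by
  by_cases hk : k % (n + 1) = 0
  · simpa [kuraX, hk] using h1
  · simpa [kuraX, hk] using h ⟨k % (n + 1) - 1, by
      have : k % (n + 1) < n + 1 := Nat.mod_lt k n.succ_pos
      omega⟩

lemma kuraX_ne_zero {x : Fin n → ℂ} (hx : ∀ j, x j ≠ 0) (k : ℕ) :
    kuraX (n + 1) n.succ_pos x k ≠ 0 :=
  kuraX_cases (P := fun f => f x ≠ 0) one_ne_zero hx k

/-- The ratios `x_{k-1} / x_k` of consecutive coordinates around the cycle. -/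
def edge (x : Fin n → ℂ) (k : Fin (n + 1)) : ℂ :=
  kuraX (n + 1) n.succ_pos x k / kuraX (n + 1) n.succ_pos x (k + 1)

lemma edge_ne_zero {x : Fin n → ℂ} (hx : ∀ j, x j ≠ 0) (k : Fin (n + 1)) : edge x k ≠ 0 :=
  div_ne_zero (kuraX_ne_zero hx _) (kuraX_ne_zero hx _)

lemma prod_edge {x : Fin n → ℂ} (hx : ∀ j, x j ≠ 0) : ∏ k, edge x k = 1 := by
  have h : ∀ m, ∏ k ∈ Finset.range m, (kuraX (n + 1) n.succ_pos x k /
      kuraX (n + 1) n.succ_pos x (k + 1)) = (kuraX (n + 1) n.succ_pos x m)⁻¹ := by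
    intro m
    induction m with
    | zero => simp [kuraX_zero]
    | succ m ih =>
      rw [Finset.prod_range_succ, ih]
      have := kuraX_ne_zero hx m
      field_simp
  have := h (n + 1)
  rw [kuraX_last, inv_one, Finset.prod_range] at this
  exact this

lemma edge_injOn : Set.InjOn (edge (n := n)) {x | ∀ j, x j ≠ 0} := by
  intro x hx x' hx' h
  have key : ∀ k, k ≤ n → kuraX (n + 1) n.succ_pos x k = kuraX (n + 1) n.succ_pos x' k := by
    intro k
    induction k with
    | zero => intro _; rw [kuraX_zero, kuraX_zero]
    | succ k ih =>
      intro hk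
      have h1 := congrFun h ⟨k, by omega⟩
      simp only [edge, ih (by omega)] at h1
      have a := kuraX_ne_zero hx' k
      have b := kuraX_ne_zero hx' (k + 1)
      have c := kuraX_ne_zero hx (k + 1)
      field_simp at h1
      exact h1.symm
  funext j
  rw [← kuraX_succ x j, ← kuraX_succ x' j]
  exact key _ (by omega)

lemma exists_edge_eq {y : Fin (n + 1) → ℂ} (hy : ∀ k, y k ≠ 0) (hprod : ∏ k, y k = 1) :
    ∃ x : Fin n → ℂ, (∀ j, x j ≠ 0) ∧ edge x = y := by
  set z : ℕ → ℂ := fun k => if h : k < n + 1 then y ⟨k, h⟩ else 1 with hz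
  have hz0 : ∀ k, z k ≠ 0 := by
    intro k
    by_cases h : k < n + 1
    · rw [hz]
      simpa only [dif_pos h] using hy _
    · rw [hz]
      simp only [dif_neg h, ne_eq, one_ne_zero, not_false_eq_true]
  have hzy : ∀ k : Fin (n + 1), z k = y k := fun k => dif_pos k.isLt
  have hp : ∀ m, ∏ i ∈ Finset.range m, z i ≠ 0 := fun m =>
    Finset.prod_ne_zero_iff.mpr fun i _ => hz0 i
  set x : Fin n → ℂ := fun j => (∏ i ∈ Finset.range (j + 1), z i)⁻¹ with hx
  have hX : ∀ k, k ≤ n + 1 →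
      kuraX (n + 1) n.succ_pos x k = (∏ i ∈ Finset.range k, z i)⁻¹ := by
    intro k hk
    rcases k with _ | k
    · simp [kuraX_zero]
    · rcases Nat.lt_or_ge k n with h | h
      · exact kuraX_succ x ⟨k, h⟩
      · obtain rfl : k = n := by omega
        rw [kuraX_last, Finset.prod_range]
        simp only [hzy, hprod, inv_one]
  refine ⟨x, fun j => inv_ne_zero (hp _), ?_⟩
  funext k
  rw [edge, hX _ (by omega), hX _ (by omega), Finset.prod_range_succ, ← hzy k]
  have := hp k
  have := hz0 k
  field_simp

lemma edge_image (P : (Fin (n + 1) → ℂ) → Prop) :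
    edge '' {x : Fin n → ℂ | (∀ j, x j ≠ 0) ∧ P (edge x)} =
      {y | (∀ k, y k ≠ 0) ∧ ∏ k, y k = 1 ∧ P y} := by
  ext y
  constructor
  · rintro ⟨x, ⟨hx, hP⟩, rfl⟩
    exact ⟨edge_ne_zero hx, prod_edge hx, hP⟩
  · rintro ⟨hy, hprod, hP⟩
    obtain ⟨x, hx, rfl⟩ := exists_edge_eq hy hprod
    exact ⟨x, ⟨hx, hP⟩, rfl⟩

lemma isLaurent_kuraX (k : ℕ) :
    IsLaurent (fun x : Fin n → ℂ => kuraX (n + 1) n.succ_pos x k) :=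
  kuraX_cases (P := IsLaurent) (IsLaurent.const 1) IsLaurent.coord k

lemma isLaurent_inv_kuraX (k : ℕ) :
    IsLaurent (fun x : Fin n → ℂ => (kuraX (n + 1) n.succ_pos x k)⁻¹) :=
  kuraX_cases (P := fun f => IsLaurent fun x => (f x)⁻¹) (by simpa using IsLaurent.const 1)
    IsLaurent.inv_coord k

lemma isLaurent_edge (k : Fin (n + 1)) : IsLaurent (fun x : Fin n → ℂ => edge x k) := by
  simp only [edge, div_eq_mul_inv]
  exact (isLaurent_kuraX _).mul (isLaurent_inv_kuraX _)

lemma isLaurent_inv_edge (k : Fin (n + 1)) :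
    IsLaurent (fun x : Fin n → ℂ => (edge x k)⁻¹) := by
  simp only [edge, inv_div]
  simp only [div_eq_mul_inv]
  exact (isLaurent_kuraX _).mul (isLaurent_inv_kuraX _)

lemma edge_one (k : Fin (n + 1)) : edge (fun _ : Fin n => 1) k = 1 := by
  have h : ∀ m, kuraX (n + 1) n.succ_pos (fun _ : Fin n => 1) m = 1 :=
    kuraX_cases (P := fun f => f (fun _ => 1) = 1) rfl fun _ => rfl
  simp [edge, h]

/-- The offsets `s_k`, partial sums of `ω / a`. -/
def offset (ω : Fin n → ℂ) (a : ℂ) (k : Fin (n + 1)) : ℂ := Fin.partialSum (fun i => ω i / a) k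

lemma forall_eq_mul_sub_iff (ω : Fin n → ℂ) {a : ℂ} (ha : a ≠ 0) (G : Fin (n + 1) → ℂ) :
    (∀ i : Fin n, ω i = a * (G i.succ - G i.castSucc)) ↔
      ∃ t, ∀ k, G k = t + offset ω a k := by
  constructor
  · intro h
    refine ⟨G 0, fun k => ?_⟩
    induction k using Fin.induction with
    | zero => simp [offset]
    | succ i ih =>
      rw [offset, Fin.partialSum_succ, ← offset, ← add_assoc, ← ih, h i]
      field_simp
      ring
  · rintro ⟨t, ht⟩ i
    rw [ht, ht, offset, Fin.partialSum_succ, ← offset]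
    field_simp
    ring

lemma kuraF_eq (ω : Fin n → ℂ) (a : ℂ) (i : Fin n) (x : Fin n → ℂ) :
    kuraF (n + 1) n.succ_pos ω a i x = ω i - a * ((edge x i.succ - (edge x i.succ)⁻¹) -
      (edge x i.castSucc - (edge x i.castSucc)⁻¹)) := by
  simp only [kuraF, edge, inv_div, Fin.val_succ, Fin.val_castSucc]
  ring

lemma kuraF_set_eq (ω : Fin n → ℂ) {a : ℂ} (ha : a ≠ 0) :
    {x : Fin n → ℂ | (∀ j, x j ≠ 0) ∧ ∀ i, kuraF (n + 1) n.succ_pos ω a i x = 0} =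
    {x : Fin n → ℂ | (∀ j, x j ≠ 0) ∧
      ∃ t, ∀ k, edge x k - (edge x k)⁻¹ = t + offset ω a k} := by
  ext x
  simp only [Set.mem_ofPred_eq]
  rw [← forall_eq_mul_sub_iff ω ha (fun k => edge x k - (edge x k)⁻¹)]
  simp only [kuraF_eq, sub_eq_zero]
  rfl

lemma mpow_facetV (lam : Fin (n + 1) → ℤ) {x : Fin n → ℂ} (hx : ∀ j, x j ≠ 0)
    (k : Fin (n + 1)) :
    mpow x (fun r => facetV (n + 1) lam r k) = edge x k ^ lam k := by
  have h1 : ∏ r : Fin n, (x r) ^ (if (r : ℕ) + 1 = (k : ℕ) then 1 else 0 : ℤ) =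
      kuraX (n + 1) n.succ_pos x k := by
    induction k using Fin.cases with
    | zero => simp [kuraX_zero]
    | succ j =>
      rw [Fin.val_succ, kuraX_succ, Finset.prod_eq_single j]
      · simp
      · intro r _ hr
        rw [if_neg (by simpa [Fin.val_inj] using hr), zpow_zero]
      · simp
  have h2 : ∏ r : Fin n, (x r) ^ (if (r : ℕ) = (k : ℕ) then 1 else 0 : ℤ) =
      kuraX (n + 1) n.succ_pos x (k + 1) := by
    induction k using Fin.lastCases with
    | last =>
      rw [Fin.val_last, kuraX_last]
      refine Finset.prod_eq_one fun r _ => ?_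
      rw [if_neg (by omega), zpow_zero]
    | cast j =>
      rw [Fin.val_castSucc, kuraX_succ, Finset.prod_eq_single j]
      · simp
      · intro r _ hr
        rw [if_neg (by simpa [Fin.val_inj] using hr), zpow_zero]
      · simp
  rw [edge, ← h1, ← h2, ← Finset.prod_div_distrib, ← Finset.prod_zpow]
  refine Finset.prod_congr rfl fun r _ => ?_
  rw [← zpow_sub₀ (hx r), ← zpow_mul, mul_comm]
  rfl

lemma sum_facetV (lam : Fin (n + 1) → ℤ) (m : Fin (n + 1) → ℂ) (r : Fin n) :
    ∑ k, (facetV (n + 1) lam r k : ℂ) * m k =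
      lam r.succ * m r.succ - lam r.castSucc * m r.castSucc := by
  have h : ∀ k, (facetV (n + 1) lam r k : ℂ) * m k =
      (if r.succ = k then (lam k : ℂ) * m k else 0) -
        (if r.castSucc = k then (lam k : ℂ) * m k else 0) := by
    intro k
    simp only [facetV, Matrix.of_apply, Fin.ext_iff, Fin.val_succ, Fin.val_castSucc]
    push_cast
    split_ifs <;> ring
  simp only [h, Finset.sum_sub_distrib, Finset.sum_ite_eq, Finset.mem_univ, if_true]

lemma facetSol_eq (ω : Fin n → ℂ) {a : ℂ} (ha : a ≠ 0) {R : Matrix (Fin n) (Fin n) ℂ}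
    (hR : IsUnit R) (lam : Fin (n + 1) → ℤ) :
    facetSol (n + 1) (R.mulVec ω) a R lam =
    {x : Fin n → ℂ | (∀ j, x j ≠ 0) ∧
      ∃ t, ∀ k, lam k * edge x k ^ lam k = t + offset ω a k} := by
  ext x
  refine and_congr_right fun hx => ?_
  rw [← forall_eq_mul_sub_iff ω ha (fun k => (lam k : ℂ) * edge x k ^ lam k)]
  set w : Fin n → ℂ := fun r => a * ∑ k, (facetV (n + 1) lam r k : ℂ) * edge x k ^ lam k
  have h1 : ∀ i : Fin n, a * ∑ k, (∑ r, R i r * (facetV (n + 1) lam r k : ℂ)) *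
      mpow x (fun r => facetV (n + 1) lam r k) = R.mulVec w i := by
    intro i
    have hm : ∀ k, mpow x (fun r => facetV (n + 1) lam r k) = edge x k ^ lam k :=
      mpow_facetV lam hx
    simp only [hm, Matrix.mulVec, dotProduct, w, Finset.mul_sum, Finset.sum_mul]
    rw [Finset.sum_comm]
    refine Finset.sum_congr rfl fun r _ => Finset.sum_congr rfl fun k _ => by ring
  have h2 : (∀ i : Fin n, (R.mulVec ω) i = a * ∑ k, (∑ r, R i r * (facetV (n + 1) lam r k : ℂ)) *
      mpow x (fun r => facetV (n + 1) lam r k)) ↔ ω = w := by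
    simp only [h1, ← funext_iff]
    exact (Matrix.mulVec_injective_iff_isUnit.mpr hR).eq_iff
  refine h2.trans (funext_iff.trans (forall_congr' fun i => ?_))
  simp only [w, sum_facetV]

end Edge

/-! ### Norm polynomials of towers of quadratic equations -/

section Norm

open scoped Polynomial Polynomial.Bivariate

lemma exists_evalEval_mul_eq (z : ℂ[X]) (G : ℂ[X][Y]) :
    ∃ A B : ℂ[X][Y], ∀ t c α : ℂ, α ^ 2 = z.eval t * α + 1 →
      G.evalEval t (α * c) = A.evalEval t c + α * B.evalEval t c := by
  induction G using Polynomial.induction_on with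
  | C p => exact ⟨Polynomial.C p, 0, fun t c α _ => by simp [Polynomial.evalEval_C]⟩
  | add P Q hP hQ =>
    obtain ⟨A, B, h⟩ := hP
    obtain ⟨A', B', h'⟩ := hQ
    refine ⟨A + A', B + B', fun t c α hα => ?_⟩
    simp only [Polynomial.evalEval_add, h t c α hα, h' t c α hα]
    ring
  | monomial n p hP =>
    obtain ⟨A, B, h⟩ := hP
    refine ⟨Polynomial.X * B, Polynomial.X * (A + Polynomial.C z * B), fun t c α hα => ?_⟩
    rw [pow_succ, ← mul_assoc, Polynomial.evalEval_mul, h t c α hα]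
    simp only [Polynomial.evalEval_mul, Polynomial.evalEval_add, Polynomial.evalEval_X,
      Polynomial.evalEval_C]
    linear_combination c * B.evalEval t c * hα

lemma exists_evalEval_norm (z : ℂ[X]) (G : ℂ[X][Y]) :
    ∃ H : ℂ[X][Y], ∀ t c α β : ℂ, α + β = z.eval t → α * β = -1 →
      H.evalEval t c = G.evalEval t (α * c) * G.evalEval t (β * c) := by
  obtain ⟨A, B, h⟩ := exists_evalEval_mul_eq z G
  refine ⟨A * A + Polynomial.C z * A * B - B * B, fun t c α β hs hp => ?_⟩
  rw [h t c α (by linear_combination α * hs - hp), h t c β (by linear_combination β * hs - hp)]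
  simp only [Polynomial.evalEval_mul, Polynomial.evalEval_add, Polynomial.evalEval_sub,
    Polynomial.evalEval_C]
  linear_combination -A.evalEval t c * B.evalEval t c * hs - B.evalEval t c ^ 2 * hp

lemma exists_evalEval_prod (m : ℕ) (z : Fin m → ℂ[X]) (G : ℂ[X][Y]) :
    ∃ H : ℂ[X][Y], ∀ (t c : ℂ) (α β : Fin m → ℂ),
      (∀ k, α k + β k = (z k).eval t ∧ α k * β k = -1) →
      H.evalEval t c =
        ∏ σ : Fin m → Bool, G.evalEval t ((∏ k, if σ k then α k else β k) * c) := by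
  induction m generalizing G with
  | zero => exact ⟨G, by simp⟩
  | succ m ih =>
    obtain ⟨G₁, h₁⟩ := exists_evalEval_norm (z 0) G
    obtain ⟨H, h⟩ := ih (fun k => z k.succ) G₁
    refine ⟨H, fun t c α β hαβ => ?_⟩
    rw [h t c (fun k => α k.succ) (fun k => β k.succ) fun k => hαβ k.succ,
      ← (Fin.consEquiv fun _ => Bool).prod_comp, Fintype.prod_prod_type_right]
    refine Finset.prod_congr rfl fun σ _ => ?_
    rw [h₁ t _ (α 0) (β 0) (hαβ 0).1 (hαβ 0).2]
    simp [Fin.consEquiv, Fin.prod_univ_succ, mul_assoc]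

/-- The polynomial whose roots are the values of `t` for which some choice of solutions of the
equations `y_k - 1 / y_k = t + s_k` has product `1`. -/
lemma exists_branch_polynomial {m : ℕ} (s : Fin m → ℂ) :
    ∃ F : ℂ[X], ∀ (t : ℂ) (α β : Fin m → ℂ),
      (∀ k, α k + β k = t + s k ∧ α k * β k = -1) →
      F.eval t = ∏ σ : Fin m → Bool, ((∏ k, if σ k then α k else β k) - 1) := by
  obtain ⟨H, h⟩ := exists_evalEval_prod m (fun k => Polynomial.X + Polynomial.C (s k))
    (Polynomial.X - 1)
  refine ⟨H.eval 1, fun t α β hαβ => ?_⟩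
  have := h t 1 α β (by simpa using hαβ)
  simp only [Polynomial.evalEval_sub, Polynomial.evalEval_X, Polynomial.evalEval_one,
    mul_one] at this
  simpa [Polynomial.evalEval] using this

end Norm

/-! ### Orders of vanishing -/

/-- The function `f` behaves like a nonzero multiple of `(u - a) ^ e` as `u → a`. -/
def HasOrd (f : ℂ → ℂ) (a : ℂ) (e : ℤ) : Prop :=
  ∃ c : ℂ, c ≠ 0 ∧ Tendsto (fun u => f u * (u - a) ^ (-e)) (𝓝[≠] a) (𝓝 c)

namespace HasOrd

variable {f g : ℂ → ℂ} {a : ℂ} {d e : ℤ}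

lemma congr (hf : HasOrd f a e) (h : ∀ᶠ u in 𝓝[≠] a, f u = g u) : HasOrd g a e := by
  obtain ⟨c, hc, hlim⟩ := hf
  refine ⟨c, hc, hlim.congr' ?_⟩
  filter_upwards [h] with u hu
  rw [hu]

lemma of_tendsto {c : ℂ} (hc : c ≠ 0) (h : Tendsto f (𝓝[≠] a) (𝓝 c)) : HasOrd f a 0 :=
  ⟨c, hc, by simpa using h⟩

lemma of_hasDerivAt {f' : ℂ} (hf : HasDerivAt f f' a) (h0 : f a = 0) (hf' : f' ≠ 0) :
    HasOrd f a 1 := by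
  refine ⟨f', hf', (hasDerivAt_iff_tendsto_slope.mp hf).congr fun u => ?_⟩
  rw [slope_def_field, h0, sub_zero, zpow_neg_one, div_eq_mul_inv]

lemma ne_eventually (a : ℂ) : ∀ᶠ u in 𝓝[≠] a, u - a ≠ 0 := by
  filter_upwards [self_mem_nhdsWithin] with u hu
  exact sub_ne_zero.mpr hu

lemma zpow (a : ℂ) (e : ℤ) : HasOrd (fun u => (u - a) ^ e) a e := by
  refine ⟨1, one_ne_zero, tendsto_const_nhds.congr' ?_⟩
  filter_upwards [ne_eventually a] with u hu
  rw [← zpow_add₀ hu, add_neg_cancel, zpow_zero]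

lemma mul (hf : HasOrd f a d) (hg : HasOrd g a e) : HasOrd (fun u => f u * g u) a (d + e) := by
  obtain ⟨b, hb, hf⟩ := hf
  obtain ⟨c, hc, hg⟩ := hg
  refine ⟨b * c, mul_ne_zero hb hc, (hf.mul hg).congr' ?_⟩
  filter_upwards [ne_eventually a] with u hu
  rw [neg_add, zpow_add₀ hu]
  ring

lemma prod {ι : Type*} (s : Finset ι) {f : ι → ℂ → ℂ} {e : ι → ℤ}
    (h : ∀ i ∈ s, HasOrd (f i) a (e i)) : HasOrd (fun u => ∏ i ∈ s, f i u) a (∑ i ∈ s, e i) := by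
  classical
  induction s using Finset.induction_on with
  | empty => simpa using of_tendsto (f := fun _ => 1) one_ne_zero tendsto_const_nhds
  | insert i s hi ih =>
    simp only [Finset.prod_insert hi, Finset.sum_insert hi]
    exact (h i (by simp)).mul (ih fun j hj => h j (by simp [hj]))

lemma not_of_lt (hf : HasOrd f a d) (hf' : HasOrd f a e) : ¬ d < e := by
  intro hlt
  obtain ⟨b, hb, h⟩ := hf
  obtain ⟨c, hc, h'⟩ := hf'
  obtain ⟨m, hm⟩ := Int.eq_ofNat_of_zero_le (sub_nonneg.mpr hlt.le)
  have hm0 : m ≠ 0 := by omega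
  have hlim : Tendsto (fun u : ℂ => (u - a) ^ m) (𝓝[≠] a) (𝓝 0) := by
    have : Tendsto (fun u : ℂ => (u - a) ^ m) (𝓝 a) (𝓝 ((a - a) ^ m)) :=
      Continuous.tendsto (by fun_prop) a
    rw [sub_self, zero_pow hm0] at this
    exact this.mono_left nhdsWithin_le_nhds
  have h2 := h'.mul hlim
  rw [mul_zero] at h2
  refine hb (tendsto_nhds_unique (h.congr' ?_) h2)
  filter_upwards [ne_eventually a] with u hu
  rw [mul_assoc, ← zpow_natCast, ← zpow_add₀ hu]
  congr 2
  omega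

lemma unique (hf : HasOrd f a d) (hf' : HasOrd f a e) : d = e :=
  le_antisymm (not_lt.mp (hf'.not_of_lt hf)) (not_lt.mp (hf.not_of_lt hf'))

lemma ne_zero (hf : HasOrd f a e) : ∃ u, f u ≠ 0 := by
  by_contra! h
  obtain ⟨c, hc, hlim⟩ := hf
  simp only [h, zero_mul] at hlim
  exact hc (tendsto_nhds_unique hlim tendsto_const_nhds)

lemma polynomial {F : Polynomial ℂ} (hF : F ≠ 0) (a : ℂ) :
    HasOrd (fun u => F.eval u) a (F.rootMultiplicity a) := by
  obtain ⟨G, hG, hnd⟩ := F.exists_eq_pow_rootMultiplicity_mul_and_not_dvd hF a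
  have h1 : HasOrd (fun u => G.eval u) a 0 :=
    of_tendsto (c := G.eval a) (fun h => hnd (Polynomial.dvd_iff_isRoot.mpr h))
      (G.continuous.tendsto a |>.mono_left nhdsWithin_le_nhds)
  have h2 := (zpow a (F.rootMultiplicity a)).mul h1
  rw [add_zero] at h2
  refine h2.congr (Eventually.of_forall fun u => ?_)
  conv_rhs => rw [hG]
  simp

lemma polynomial_inv {F : Polynomial ℂ} (hF : F ≠ 0) :
    HasOrd (fun u => F.eval u⁻¹) 0 (-F.natDegree) := by
  have h1 : HasOrd (fun u => F.reverse.eval u) 0 0 :=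
    of_tendsto (c := F.leadingCoeff) (Polynomial.leadingCoeff_ne_zero.mpr hF) (by
      have := F.reverse.continuous.tendsto 0 |>.mono_left (nhdsWithin_le_nhds (s := {0}ᶜ))
      rwa [← Polynomial.coeff_zero_eq_eval_zero, Polynomial.coeff_zero_reverse] at this)
  have h2 := h1.mul (zpow 0 (-F.natDegree))
  rw [zero_add] at h2
  refine h2.congr ?_
  filter_upwards [ne_eventually 0] with u hu
  rw [sub_zero] at hu ⊢
  have hu' : u⁻¹ ≠ 0 := inv_ne_zero hu
  let _ := invertibleOfNonzero hu'
  have := Polynomial.eval₂_reverse_mul_pow (RingHom.id ℂ) u⁻¹ F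
  rw [invOf_eq_inv, inv_inv] at this
  simpa [Polynomial.eval₂_id] using this

lemma rootMultiplicity_eq {F : Polynomial ℂ} (h : HasOrd (fun u => F.eval u) a e) :
    (F.rootMultiplicity a : ℤ) = e :=
  (polynomial (fun h0 => by subst h0; simpa using h.ne_zero) a).unique h

lemma natDegree_eq {F : Polynomial ℂ} (h : HasOrd (fun u => F.eval u⁻¹) 0 (-e)) :
    F ≠ 0 ∧ (F.natDegree : ℤ) = e := by
  have hF : F ≠ 0 := fun h0 => by subst h0; simpa using h.ne_zero
  exact ⟨hF, neg_injective ((polynomial_inv hF).unique h)⟩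

end HasOrd

lemma hasDerivAt_prod_of_log {ι : Type*} [Fintype ι] {f : ι → ℂ → ℂ} {l : ι → ℂ} {a : ℂ}
    (hf : ∀ k, HasDerivAt (f k) (f k a * l k) a) :
    HasDerivAt (fun u => ∏ k, f k u) ((∏ k, f k a) * ∑ k, l k) a := by
  classical
  have h := HasDerivAt.fun_finsetProd (u := Finset.univ) fun k _ => hf k
  refine h.congr_deriv ?_
  rw [Finset.mul_sum]
  refine Finset.sum_congr rfl fun k _ => ?_
  rw [smul_eq_mul, ← mul_assoc, Finset.prod_erase_mul _ _ (Finset.mem_univ k)]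

lemma exists_hasDerivAt_sqrt {v : ℂ → ℂ} {v' r₀ a : ℂ} (hv : HasDerivAt v v' a)
    (h : v a = r₀ ^ 2) (hr₀ : r₀ ≠ 0) :
    ∃ r : ℂ → ℂ, (∀ u, r u ^ 2 = v u) ∧ r a = r₀ ∧ HasDerivAt r (v' / (2 * r₀)) a := by
  refine ⟨fun u => r₀ * (v u / r₀ ^ 2) ^ (2⁻¹ : ℂ), fun u => ?_, ?_, ?_⟩
  · have := Complex.cpow_nat_inv_pow (v u / r₀ ^ 2) two_ne_zero
    push_cast at this
    rw [mul_pow, this]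
    field_simp
  · simp [h, hr₀]
  · have h1 : v a / r₀ ^ 2 = 1 := by rw [h]; field_simp
    have := ((hv.div_const (r₀ ^ 2)).cpow_const (c := (2⁻¹ : ℂ)) (by simp [h1])).const_mul r₀
    refine this.congr_deriv ?_
    rw [h1]
    simp
    field_simp

/-! ### Sign vectors -/

section Sign

variable {m : ℕ} (σ : Fin m → Bool)

lemma signVec_ne_zero (k : Fin m) : signVec σ k ≠ 0 := by
  unfold signVec
  split_ifs <;> simp

lemma signVec_mul_self (k : Fin m) : (signVec σ k : ℂ) * signVec σ k = 1 := by
  unfold signVec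
  split_ifs <;> simp

lemma sum_signVec : ∑ k, signVec σ k = 2 * (Finset.univ.filter fun k => σ k = true).card - m := by
  have h : ∀ k, signVec σ k = 2 * (if σ k = true then 1 else 0) - 1 := by
    intro k
    unfold signVec
    split_ifs <;> simp
  simp only [h, Finset.sum_sub_distrib, ← Finset.mul_sum, Finset.sum_boole]
  simp

lemma prod_signVec :
    ∏ k, (signVec σ k : ℂ) = (-1) ^ (Finset.univ.filter fun k => ¬ σ k = true).card := by
  simp only [signVec, Int.cast_ite, Int.cast_one, Int.cast_neg]
  rw [Finset.prod_ite]
  simp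

lemma card_true_of_sum_eq_zero {M : ℕ} (hm : m = 2 * M) (h : ∑ k, signVec σ k = 0) :
    (Finset.univ.filter fun k => σ k = true).card = M := by
  rw [sum_signVec] at h
  omega

lemma prod_signVec_of_sum_eq_zero {M : ℕ} (hm : m = 2 * M) (h : ∑ k, signVec σ k = 0) :
    ∏ k, (signVec σ k : ℂ) = (-1) ^ M := by
  rw [prod_signVec]
  have h1 := card_true_of_sum_eq_zero σ hm h
  have h2 := Finset.card_filter_add_card_filter_not (s := Finset.univ) (fun k => σ k = true)
  rw [Finset.card_univ, Fintype.card_fin] at h2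
  congr 1
  omega

lemma sum_bool_apply_card {A : Type*} [AddCommMonoid A] (f : ℕ → A) :
    ∑ σ : Fin m → Bool, f (Finset.univ.filter fun k => σ k = true).card =
      ∑ j ∈ Finset.range (m + 1), m.choose j • f j := by
  have h := Finset.sum_powerset_apply_card f (x := (Finset.univ : Finset (Fin m)))
  rw [Finset.card_univ, Fintype.card_fin] at h
  rw [← h]
  refine Finset.sum_bij' (fun σ _ => Finset.univ.filter fun k => σ k = true)
    (fun S _ k => decide (k ∈ S)) ?_ ?_ ?_ ?_ ?_ <;> simp

lemma sum_pos_signVec {M : ℕ} (hm : m = 2 * M) :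
    ∑ σ : Fin m → Bool, (if 0 < ∑ k, signVec σ k then ∑ k, signVec σ k else 0) =
      ∑ _σ ∈ Finset.univ.filter (fun σ : Fin m → Bool => ∑ k, signVec σ k = 0), (M : ℤ) := by
  have h1 := sum_bool_apply_card (m := m)
    (fun j => if 0 < 2 * (j : ℤ) - m then 2 * (j : ℤ) - m else 0)
  have h2 := sum_bool_apply_card (m := m) (fun j => if 2 * (j : ℤ) - m = 0 then (M : ℤ) else 0)
  simp only [Finset.sum_filter, sum_signVec]
  rw [h1, h2]
  subst hm
  have h3 : ∀ j : ℕ, 2 * (j : ℤ) - (2 * M : ℕ) = 0 ↔ j = M := fun j => by omega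
  have h4 : ∀ j : ℕ, 0 < 2 * (j : ℤ) - (2 * M : ℕ) ↔ M < j := fun j => by omega
  simp only [h3, h4, nsmul_eq_mul]
  have key : ∀ d, ∑ j ∈ Finset.range (M + d), ((2 * M).choose j : ℤ) *
      (if M < j then 2 * (j : ℤ) - (2 * M : ℕ) else 0) =
      if d = 0 then 0 else (M : ℤ) * (2 * M).choose M - (M + d) * (2 * M).choose (M + d) := by
    intro d
    induction d with
    | zero =>
      rw [if_pos rfl]
      refine Finset.sum_eq_zero fun j hj => ?_
      rw [if_neg (by simp at hj; omega), mul_zero]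
    | succ d ih =>
      rw [← add_assoc, Finset.sum_range_succ, ih, if_neg d.succ_ne_zero]
      have h := Nat.choose_succ_right_eq (2 * M) (M + d)
      rcases Nat.eq_zero_or_pos d with rfl | hd
      · have h' : ((2 * M).choose (M + 1) : ℤ) * (M + 1) = (2 * M).choose M * M := by
          rw [add_zero, show 2 * M - M = M by omega] at h
          exact_mod_cast h
        simp
        linarith
      · rw [if_neg hd.ne', if_pos (by omega)]
        rcases Nat.lt_or_ge M d with hdM | hdM
        · simp [Nat.choose_eq_zero_of_lt (show 2 * M < M + d by omega),
            Nat.choose_eq_zero_of_lt (show 2 * M < M + d + 1 by omega)]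
        · have h' : ((2 * M).choose (M + d + 1) : ℤ) * (M + d + 1) =
              (2 * M).choose (M + d) * (M - d) := by
            rw [show 2 * M - (M + d) = M - d by omega] at h
            have := congrArg (Nat.cast : ℕ → ℤ) h
            push_cast [Nat.cast_sub hdM] at this
            exact this
          push_cast
          linarith
  rw [show 2 * M + 1 = M + (M + 1) by omega, key (M + 1), if_neg M.succ_ne_zero,
    Nat.choose_eq_zero_of_lt (show 2 * M < M + (M + 1) by omega)]
  rw [Finset.sum_eq_single M]
  · simp [mul_comm]
  · intro j _ hj
    simp [hj]
  · simp

end Sign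

/-! ### Counting solutions in edge coordinates -/

section Count

variable {m : ℕ}

lemma exists_local_branch {s t₀ α₀ β₀ : ℂ} (hs : α₀ + β₀ = t₀ + s) (hp : α₀ * β₀ = -1)
    (hne : α₀ ≠ β₀) :
    ∃ α β : ℂ → ℂ, (∀ t, α t + β t = t + s ∧ α t * β t = -1) ∧ α t₀ = α₀ ∧ β t₀ = β₀ ∧
      HasDerivAt α (α₀ * (α₀ + α₀⁻¹)⁻¹) t₀ ∧ HasDerivAt β (β₀ * (β₀ + β₀⁻¹)⁻¹) t₀ := by
  have hr : α₀ - β₀ ≠ 0 := sub_ne_zero.mpr hne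
  have hid : HasDerivAt (fun t => t + s) 1 t₀ := (hasDerivAt_id t₀).add_const s
  obtain ⟨r, hr2, hr0, hr'⟩ := exists_hasDerivAt_sqrt (r₀ := α₀ - β₀)
    ((hid.pow 2).add_const 4) (by simp only [Pi.pow_apply, ← hs]; linear_combination 4 * hp) hr
  have hr2' : ∀ t, r t ^ 2 = (t + s) ^ 2 + 4 := hr2
  have hα : α₀⁻¹ = -β₀ := inv_eq_of_mul_eq_one_right (by linear_combination -hp)
  have hβ : β₀⁻¹ = -α₀ := inv_eq_of_mul_eq_one_right (by linear_combination -hp)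
  have hr3 : β₀ - α₀ ≠ 0 := sub_ne_zero.mpr hne.symm
  refine ⟨fun t => (t + s + r t) / 2, fun t => (t + s - r t) / 2, fun t => ⟨by ring, ?_⟩, ?_, ?_,
    ((hid.add hr').div_const 2).congr_deriv ?_, ((hid.sub hr').div_const 2).congr_deriv ?_⟩
  · linear_combination -hr2' t / 4
  · simp only [hr0, ← hs]; ring
  · simp only [hr0, ← hs]; ring
  · rw [hα, ← sub_eq_add_neg, ← hs]
    field_simp
    push_cast
    ring
  · rw [hβ, ← sub_eq_add_neg, ← hs, eq_mul_inv_iff_mul_eq₀ hr3]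
    field_simp
    push_cast
    ring

lemma hasDerivAt_ite {c : Prop} [Decidable c] {f g : ℂ → ℂ} {f' g' a : ℂ}
    (hf : HasDerivAt f f' a) (hg : HasDerivAt g g' a) :
    HasDerivAt (fun u => if c then f u else g u) (if c then f' else g') a := by
  by_cases h : c <;> simpa [h]

lemma rootMultiplicity_branch_polynomial {s : Fin m → ℂ} {F : Polynomial ℂ}
    (hF : ∀ (t : ℂ) (α β : Fin m → ℂ), (∀ k, α k + β k = t + s k ∧ α k * β k = -1) →
      F.eval t = ∏ σ : Fin m → Bool, ((∏ k, if σ k then α k else β k) - 1))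
    {t₀ : ℂ} {α₀ β₀ : Fin m → ℂ} (h₀ : ∀ k, α₀ k + β₀ k = t₀ + s k ∧ α₀ k * β₀ k = -1)
    (hne : ∀ k, α₀ k ≠ β₀ k)
    (hreg : ∀ σ : Fin m → Bool, ∏ k, (if σ k then α₀ k else β₀ k) = 1 →
      ∑ k, ((if σ k then α₀ k else β₀ k) + (if σ k then α₀ k else β₀ k)⁻¹)⁻¹ ≠ 0) :
    F.rootMultiplicity t₀ = (Finset.univ.filter fun σ : Fin m → Bool =>
      ∏ k, (if σ k then α₀ k else β₀ k) = 1).card := by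
  choose α β hαβ hα hβ hα' hβ' using fun k => exists_local_branch (h₀ k).1 (h₀ k).2 (hne k)
  have hder : ∀ σ : Fin m → Bool, HasDerivAt
      (fun t => (∏ k, if σ k then α k t else β k t) - 1)
      ((∏ k, if σ k then α₀ k else β₀ k) *
        ∑ k, ((if σ k then α₀ k else β₀ k) + (if σ k then α₀ k else β₀ k)⁻¹)⁻¹) t₀ := by
    intro σ
    refine HasDerivAt.sub_const _ ?_
    have := hasDerivAt_prod_of_log (a := t₀) (f := fun k t => if σ k then α k t else β k t)
      (l := fun k => ((if σ k then α₀ k else β₀ k) + (if σ k then α₀ k else β₀ k)⁻¹)⁻¹) ?_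
    · simpa only [hα, hβ] using this
    · intro k
      refine (hasDerivAt_ite (hα' k) (hβ' k)).congr_deriv ?_
      simp only [hα, hβ]
      split_ifs <;> rfl
  have hord : HasOrd (fun t => F.eval t) t₀ (∑ σ : Fin m → Bool,
      if ∏ k, (if σ k then α₀ k else β₀ k) = 1 then 1 else 0) := by
    simp only [fun t => hF t (fun k => α k t) (fun k => β k t) fun k => hαβ k t]
    refine HasOrd.prod _ fun σ _ => ?_
    split_ifs with h1
    · refine HasOrd.of_hasDerivAt (hder σ) ?_ (mul_ne_zero (by simp [h1]) (hreg σ h1))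
      simp only [hα, hβ, h1, sub_self]
    · refine HasOrd.of_tendsto (c := (∏ k, if σ k then α₀ k else β₀ k) - 1)
        (sub_ne_zero.mpr h1) ?_
      simpa only [hα, hβ] using (hder σ).continuousAt.tendsto.mono_left nhdsWithin_le_nhds
  have := hord.rootMultiplicity_eq
  rw [Finset.sum_boole] at this
  exact_mod_cast this

lemma exists_add_eq_mul_eq_neg_one (z : ℂ) : ∃ α β : ℂ, α + β = z ∧ α * β = -1 := by
  obtain ⟨r, hr⟩ := IsAlgClosed.exists_pow_nat_eq (z ^ 2 + 4) two_pos
  exact ⟨(z + r) / 2, (z - r) / 2, by ring, by linear_combination -hr / 4⟩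

/-- If all solutions are regular, they are counted by the degree of the branch polynomial. -/
lemma ncard_branch_solutions [NeZero m] {s : Fin m → ℂ} {F : Polynomial ℂ} (hF0 : F ≠ 0)
    (hF : ∀ (t : ℂ) (α β : Fin m → ℂ), (∀ k, α k + β k = t + s k ∧ α k * β k = -1) →
      F.eval t = ∏ σ : Fin m → Bool, ((∏ k, if σ k then α k else β k) - 1))
    (hreg : ∀ y : Fin m → ℂ, (∀ k, y k ≠ 0) → ∏ k, y k = 1 →
      (∃ t, ∀ k, y k - (y k)⁻¹ = t + s k) →
      (∀ k, y k + (y k)⁻¹ ≠ 0) ∧ ∑ k, (y k + (y k)⁻¹)⁻¹ ≠ 0) :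
    {y : Fin m → ℂ | (∀ k, y k ≠ 0) ∧ ∏ k, y k = 1 ∧
      ∃ t, ∀ k, y k - (y k)⁻¹ = t + s k}.Finite ∧
    {y : Fin m → ℂ | (∀ k, y k ≠ 0) ∧ ∏ k, y k = 1 ∧
      ∃ t, ∀ k, y k - (y k)⁻¹ = t + s k}.ncard = F.natDegree := by
  classical
  choose α β hαβ using fun (t : ℂ) (k : Fin m) => exists_add_eq_mul_eq_neg_one (t + s k)
  set Y : (Σ _ : ℂ, Fin m → Bool) → Fin m → ℂ :=
    fun p k => if p.2 k then α p.1 k else β p.1 k with hY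
  have hα0 : ∀ t k, α t k ≠ 0 := fun t k h => by simpa [h] using (hαβ t k).2
  have hβ0 : ∀ t k, β t k ≠ 0 := fun t k h => by simpa [h] using (hαβ t k).2
  have hαinv : ∀ t k, (α t k)⁻¹ = -β t k := fun t k =>
    inv_eq_of_mul_eq_one_right (by linear_combination -(hαβ t k).2)
  have hβinv : ∀ t k, (β t k)⁻¹ = -α t k := fun t k =>
    inv_eq_of_mul_eq_one_right (by linear_combination -(hαβ t k).2)
  have hY0 : ∀ p k, Y p k ≠ 0 := fun p k => by
    simp only [hY]; split_ifs <;> simp [hα0, hβ0]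
  have hYt : ∀ p k, Y p k - (Y p k)⁻¹ = p.1 + s k := fun p k => by
    rw [← (hαβ p.1 k).1]
    simp only [hY]
    split_ifs
    · rw [hαinv, sub_neg_eq_add]
    · rw [hβinv, sub_neg_eq_add, add_comm]
  have hregY : ∀ p, ∏ k, Y p k = 1 →
      (∀ k, Y p k + (Y p k)⁻¹ ≠ 0) ∧ ∑ k, (Y p k + (Y p k)⁻¹)⁻¹ ≠ 0 := fun p hp =>
    hreg _ (hY0 p) hp ⟨p.1, hYt p⟩
  have hne : ∀ p, ∏ k, Y p k = 1 → ∀ k, α p.1 k ≠ β p.1 k := fun p hp k h => by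
    refine (hregY p hp).1 k ?_
    simp only [hY]
    split_ifs
    · rw [hαinv, h, add_neg_cancel]
    · rw [hβinv, h, add_neg_cancel]
  set T : Finset (Σ _ : ℂ, Fin m → Bool) := F.roots.toFinset.sigma fun t =>
    Finset.univ.filter fun σ : Fin m → Bool => ∏ k, Y ⟨t, σ⟩ k = 1 with hT
  have hmemT : ∀ p, p ∈ T ↔ ∏ k, Y p k = 1 := by
    rintro ⟨t, σ⟩
    simp only [hT, Finset.mem_sigma, Multiset.mem_toFinset, Finset.mem_filter, Finset.mem_univ,
      true_and, and_iff_right_iff_imp]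
    intro h
    rw [Polynomial.mem_roots hF0, Polynomial.IsRoot.def, hF t (α t) (β t) (hαβ t)]
    exact Finset.prod_eq_zero (Finset.mem_univ σ) (sub_eq_zero.mpr h)
  have himage : {y : Fin m → ℂ | (∀ k, y k ≠ 0) ∧ ∏ k, y k = 1 ∧
      ∃ t, ∀ k, y k - (y k)⁻¹ = t + s k} = Y '' T := by
    ext y
    simp only [Set.mem_ofPred_eq, Set.mem_image, Finset.mem_coe]
    constructor
    · rintro ⟨hy, hprod, t, ht⟩
      have hyY : Y ⟨t, fun k => decide (y k = α t k)⟩ = y := by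
        funext k
        have h1 : (y k - α t k) * (y k - β t k) = 0 := by
          have h2 := ht k
          have h3 := hy k
          field_simp at h2
          linear_combination h2 - y k * (hαβ t k).1 + (hαβ t k).2
        simp only [hY, decide_eq_true_eq]
        split_ifs with h
        · exact h.symm
        · exact (sub_eq_zero.mp ((mul_eq_zero.mp h1).resolve_left (sub_ne_zero.mpr h))).symm
      exact ⟨_, (hmemT _).mpr (by rw [hyY, hprod]), hyY⟩
    · rintro ⟨p, hp, rfl⟩
      exact ⟨hY0 p, (hmemT p).mp hp, p.1, hYt p⟩
  have hinj : Set.InjOn Y T := by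
    rintro ⟨t, σ⟩ hp ⟨t', σ'⟩ hp' h
    have h1 := hYt ⟨t, σ⟩ 0
    have h2 := hYt ⟨t', σ'⟩ 0
    rw [h] at h1
    obtain rfl : t = t' := add_right_cancel (h1.symm.trans h2)
    congr
    funext k
    have h3 := congrFun h k
    have h4 := hne _ ((hmemT _).mp hp) k
    simp only [hY] at h3 h4
    cases hk : σ k <;> cases hk' : σ' k <;> simp [hk, hk'] at h3 ⊢
    · exact h4 h3.symm
    · exact h4 h3
  rw [himage]
  refine ⟨T.finite_toSet.image _, ?_⟩
  rw [hinj.ncard_image, Set.ncard_coe_finset, hT, Finset.card_sigma,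
    ← IsAlgClosed.card_roots_eq_natDegree, ← Multiset.toFinset_sum_count_eq]
  refine Finset.sum_congr rfl fun t ht => ?_
  rw [Polynomial.count_roots]
  rw [Multiset.mem_toFinset, Polynomial.mem_roots hF0, Polynomial.IsRoot.def,
    hF t (α t) (β t) (hαβ t), Finset.prod_eq_zero_iff] at ht
  obtain ⟨σ, _, hσ⟩ := ht
  exact (rootMultiplicity_branch_polynomial hF (hαβ t) (hne ⟨t, σ⟩ (sub_eq_zero.mp hσ))
    fun σ' hσ' => (hregY ⟨t, σ'⟩ hσ').2).symm

end Count

section Degree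

variable {m : ℕ}

lemma exists_branch_at_infinity (s : ℂ) :
    ∃ w : ℂ → ℂ, w 0 = 1 ∧ HasDerivAt w s 0 ∧ (∀ u, u ≠ 0 → w u ≠ 0) ∧
      ∀ u, u ≠ 0 → w u / u - u / w u = u⁻¹ + s := by
  have hid : HasDerivAt (fun u : ℂ => 1 + s * u) s 0 := by
    simpa using ((hasDerivAt_id (0 : ℂ)).const_mul s).const_add 1
  have hv : HasDerivAt (fun u : ℂ => (1 + s * u) ^ 2 + 4 * u ^ 2) (2 * s) 0 := by
    have h2 : HasDerivAt (fun u : ℂ => 4 * u ^ 2) 0 0 := by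
      simpa using ((hasDerivAt_id (0 : ℂ)).pow 2).const_mul 4
    exact ((hid.pow 2).add h2).congr_deriv (by simp)
  obtain ⟨r, hr2, hr0, hr'⟩ := exists_hasDerivAt_sqrt (r₀ := 1) hv (by simp) one_ne_zero
  have hw : ∀ u, ((1 + s * u + r u) / 2) ^ 2 = (1 + s * u) * ((1 + s * u + r u) / 2) + u ^ 2 :=
    fun u => by linear_combination hr2 u / 4
  have hw0 : ∀ u, u ≠ 0 → (1 + s * u + r u) / 2 ≠ 0 := fun u hu h => hu (by
    simpa [h] using (hw u).symm)
  refine ⟨fun u => (1 + s * u + r u) / 2, ?_, ((hid.add hr').div_const 2).congr_deriv ?_, hw0,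
    fun u hu => ?_⟩
  · simp only [hr0]; norm_num
  · ring
  · have h1 := hw u
    have h2 := hw0 u hu
    show (1 + s * u + r u) / 2 / u - u / ((1 + s * u + r u) / 2) = u⁻¹ + s
    generalize (1 + s * u + r u) / 2 = W at h1 h2 ⊢
    field_simp
    linear_combination h1

lemma HasDerivAt.zpow_signVec {f : ℂ → ℂ} {f' a : ℂ} (hf : HasDerivAt f f' a) (h1 : f a = 1)
    (σ : Fin m → Bool) (k : Fin m) :
    HasDerivAt (fun u => f u ^ signVec σ k) (signVec σ k * f') a := by
  unfold signVec
  split_ifs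
  · simpa using hf
  · simpa [h1] using hf.fun_inv (by simp [h1])

/-- The degree of the branch polynomial. -/
lemma natDegree_branch_polynomial {M : ℕ} (hm : m = 2 * M) {s : Fin m → ℂ} {F : Polynomial ℂ}
    (hF : ∀ (t : ℂ) (α β : Fin m → ℂ), (∀ k, α k + β k = t + s k ∧ α k * β k = -1) →
      F.eval t = ∏ σ : Fin m → Bool, ((∏ k, if σ k then α k else β k) - 1))
    (hs : ∀ σ : Fin m → Bool, ∑ k, signVec σ k = 0 → ∑ k, (signVec σ k : ℂ) * s k ≠ 0) :
    F ≠ 0 ∧ F.natDegree =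
      ∑ _σ ∈ Finset.univ.filter (fun σ : Fin m → Bool => ∑ k, signVec σ k = 0),
        ((M : ℤ) - if Even M then 1 else 0) := by
  choose w hw0 hw' hwne hw using fun k => exists_branch_at_infinity (s k)
  have hder : ∀ σ : Fin m → Bool, HasDerivAt (fun u => ∏ k, w k u ^ signVec σ k)
      (∑ k, (signVec σ k : ℂ) * s k) 0 := by
    intro σ
    have := hasDerivAt_prod_of_log (f := fun k u => w k u ^ signVec σ k)
      (l := fun k => signVec σ k * s k) (a := 0) fun k => by
        simpa [hw0] using (hw' k).zpow_signVec (hw0 k) σ k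
    simpa [hw0] using this
  have hlim : ∀ (σ : Fin m → Bool) (c : ℂ), Tendsto (fun u => c * ∏ k, w k u ^ signVec σ k)
      (𝓝[≠] 0) (𝓝 c) := by
    intro σ c
    have := ((hder σ).const_mul c).continuousAt.tendsto.mono_left
      (nhdsWithin_le_nhds (s := {0}ᶜ))
    simpa [hw0] using this
  have hpos : ∀ n : ℤ, 0 < n → Tendsto (fun u : ℂ => u ^ n) (𝓝[≠] 0) (𝓝 0) := by
    intro n hn
    obtain ⟨d, rfl⟩ := Int.eq_ofNat_of_zero_le hn.le
    have : Tendsto (fun u : ℂ => u ^ d) (𝓝 0) (𝓝 (0 ^ d)) :=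
      Continuous.tendsto (by fun_prop) 0
    rw [zero_pow (by omega)] at this
    simpa using this.mono_left nhdsWithin_le_nhds
  have hε : ∀ σ : Fin m → Bool, ∏ k, (signVec σ k : ℂ) ≠ 0 := fun σ =>
    Finset.prod_ne_zero_iff.mpr fun k _ => Int.cast_ne_zero.mpr (signVec_ne_zero σ k)
  have hfac : ∀ σ : Fin m → Bool, HasOrd (fun u => (∏ k, (signVec σ k : ℂ)) *
      (∏ k, w k u ^ signVec σ k) * u ^ (-∑ k, signVec σ k) - 1) 0
      (-((if 0 < ∑ k, signVec σ k then ∑ k, signVec σ k else 0) -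
        if ∑ k, signVec σ k = 0 then (if Even M then 1 else 0) else 0)) := by
    intro σ
    set S := ∑ k, signVec σ k with hS
    rcases lt_trichotomy S 0 with h | h | h
    · rw [if_neg h.not_gt, if_neg h.ne]
      refine HasOrd.of_tendsto (c := -1) (by norm_num) ?_
      simpa using ((hlim σ _).mul (hpos (-S) (by omega))).sub_const 1
    · rw [if_neg (by omega), if_pos h, h]
      rw [hS] at h
      simp only [neg_zero, zpow_zero, mul_one, prod_signVec_of_sum_eq_zero σ hm h]
      split_ifs with hM
      · simp only [hM.neg_one_pow, one_mul, zero_sub, neg_neg]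
        exact HasOrd.of_hasDerivAt ((hder σ).sub_const 1) (by simp [hw0]) (hs σ h)
      · refine HasOrd.of_tendsto (c := -1 - 1) (by norm_num) ?_
        rw [(Nat.not_even_iff_odd.mp hM).neg_one_pow]
        exact (hlim σ _).sub_const 1
    · rw [if_pos h, if_neg h.ne', sub_zero]
      have h1 : HasOrd (fun u => (∏ k, (signVec σ k : ℂ)) * (∏ k, w k u ^ signVec σ k) - u ^ S)
          0 0 := by
        refine HasOrd.of_tendsto (hε σ) ?_
        simpa using (hlim σ (∏ k, (signVec σ k : ℂ))).sub (hpos S h)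
      have h2 := h1.mul (HasOrd.zpow 0 (-S))
      rw [zero_add] at h2
      refine h2.congr ?_
      filter_upwards [HasOrd.ne_eventually 0] with u hu
      rw [sub_zero] at hu ⊢
      rw [sub_mul, ← zpow_add₀ hu, add_neg_cancel, zpow_zero]
  have hord := HasOrd.prod Finset.univ fun σ _ => hfac σ
  rw [Finset.sum_neg_distrib] at hord
  have hF' : HasOrd (fun u => F.eval u⁻¹) 0 (-∑ σ : Fin m → Bool,
      ((if 0 < ∑ k, signVec σ k then ∑ k, signVec σ k else 0) -
        if ∑ k, signVec σ k = 0 then (if Even M then 1 else 0) else 0)) := by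
    refine hord.congr ?_
    filter_upwards [HasOrd.ne_eventually 0] with u hu
    rw [sub_zero] at hu
    rw [hF u⁻¹ (fun k => w k u / u) (fun k => -(u / w k u)) fun k => ⟨by
      rw [← hw k u hu, sub_eq_add_neg], by
      have := hwne k u hu
      field_simp⟩]
    refine Finset.prod_congr rfl fun σ _ => ?_
    have hz : u ^ (-∑ k, signVec σ k) = ∏ k, u ^ (-signVec σ k) := by
      rw [← Finset.sum_neg_distrib]
      generalize (Finset.univ : Finset (Fin m)) = A
      induction A using Finset.induction_on with
      | empty => simp
      | insert a A ha ih => rw [Finset.sum_insert ha, Finset.prod_insert ha, zpow_add₀ hu, ih]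
    rw [hz, ← Finset.prod_mul_distrib, ← Finset.prod_mul_distrib]
    congr 1
    refine Finset.prod_congr rfl fun k _ => ?_
    unfold signVec
    split_ifs
    · simp [div_eq_mul_inv]
    · simp [div_eq_mul_inv, mul_comm]
  obtain ⟨h0, hdeg⟩ := hF'.natDegree_eq
  refine ⟨h0, ?_⟩
  rw [hdeg, Finset.sum_sub_distrib, sum_pos_signVec hm, Finset.sum_sub_distrib]
  congr 1
  rw [Finset.sum_filter]

/-- The number of solutions of a facet subsystem in edge coordinates. -/
lemma ncard_facet_solutions [NeZero m] {M : ℕ} (hm : m = 2 * M) {s : Fin m → ℂ}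
    {σ : Fin m → Bool} (hσ : ∑ k, signVec σ k = 0) (hinj : Function.Injective s)
    (hs : ∑ k, (signVec σ k : ℂ) * s k ≠ 0)
    (hreg : ∀ y : Fin m → ℂ, (∀ k, y k ≠ 0) → ∏ k, y k = 1 →
      (∃ t, ∀ k, signVec σ k * y k ^ signVec σ k = t + s k) →
      ∑ k, (y k ^ signVec σ k)⁻¹ ≠ 0) :
    {y : Fin m → ℂ | (∀ k, y k ≠ 0) ∧ ∏ k, y k = 1 ∧
      ∃ t, ∀ k, signVec σ k * y k ^ signVec σ k = t + s k}.Finite ∧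
    ({y : Fin m → ℂ | (∀ k, y k ≠ 0) ∧ ∏ k, y k = 1 ∧
      ∃ t, ∀ k, signVec σ k * y k ^ signVec σ k = t + s k}.ncard : ℤ) =
      M - if Even M then 1 else 0 := by
  classical
  set ε : ℂ := (-1) ^ M with hε
  have hε2 : ε * ε = 1 := by rw [hε, ← mul_pow]; simp
  have hε0 : ε ≠ 0 := left_ne_zero_of_mul_eq_one hε2
  have hprodε : ∏ k, (signVec σ k : ℂ) = ε := prod_signVec_of_sum_eq_zero σ hm hσ
  set H : Polynomial ℂ := (∏ k, if σ k then Polynomial.X + Polynomial.C (s k) else 1) -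
    Polynomial.C ε * ∏ k, if σ k then 1 else Polynomial.X + Polynomial.C (s k) with hH
  have hHt : ∀ t, H.eval t = (∏ k, if σ k then t + s k else 1) -
      ε * ∏ k, if σ k then 1 else t + s k := by
    intro t
    simp only [hH, Polynomial.eval_sub, Polynomial.eval_mul, Polynomial.eval_prod,
      Polynomial.eval_C, apply_ite (Polynomial.eval t), Polynomial.eval_add, Polynomial.eval_X,
      Polynomial.eval_one]
  -- the degree of `H`
  have hlin : ∀ k, HasDerivAt (fun u : ℂ => 1 + s k * u) (s k) 0 := fun k => by
    simpa using ((hasDerivAt_id (0 : ℂ)).const_mul (s k)).const_add 1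
  have hK : HasDerivAt (fun u : ℂ => (∏ k, if σ k then 1 + s k * u else 1) -
      ε * ∏ k, if σ k then 1 else 1 + s k * u)
      ((∑ k, if σ k then s k else 0) - ε * ∑ k, if σ k then 0 else s k) 0 := by
    refine HasDerivAt.sub ?_ (HasDerivAt.const_mul ε ?_)
    · have := hasDerivAt_prod_of_log (f := fun k u => if σ k then 1 + s k * u else 1)
        (l := fun k => if σ k then s k else 0) (a := 0) fun k =>
          (hasDerivAt_ite (hlin k) (hasDerivAt_const _ _)).congr_deriv (by split_ifs <;> simp)
      simpa using this
    · have := hasDerivAt_prod_of_log (f := fun k u => if σ k then 1 else 1 + s k * u)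
        (l := fun k => if σ k then 0 else s k) (a := 0) fun k =>
          (hasDerivAt_ite (hasDerivAt_const _ _) (hlin k)).congr_deriv (by split_ifs <;> simp)
      simpa using this
  have hKord : HasOrd (fun u : ℂ => (∏ k, if σ k then 1 + s k * u else 1) -
      ε * ∏ k, if σ k then 1 else 1 + s k * u) 0 (if Even M then 1 else 0) := by
    split_ifs with hM
    · have hε1 : ε = 1 := hM.neg_one_pow
      refine HasOrd.of_hasDerivAt hK (by simp [hε1]) ?_
      convert hs using 1
      rw [hε1, one_mul, ← Finset.sum_sub_distrib]
      refine Finset.sum_congr rfl fun k _ => ?_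
      unfold signVec
      split_ifs <;> simp
    · have hε1 : ε = -1 := (Nat.not_even_iff_odd.mp hM).neg_one_pow
      refine HasOrd.of_tendsto (c := 1 + 1) (by norm_num) ?_
      simpa [hε1] using hK.continuousAt.tendsto.mono_left (nhdsWithin_le_nhds (s := {0}ᶜ))
  have hcard : (Finset.univ.filter fun k => σ k = true).card = M :=
    card_true_of_sum_eq_zero σ hm hσ
  have hcard' : (Finset.univ.filter fun k => σ k = false).card = M := by
    have h2 := Finset.card_filter_add_card_filter_not (s := Finset.univ) (fun k => σ k = true)
    simp only [Finset.card_univ, Fintype.card_fin, Bool.not_eq_true] at h2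
    omega
  have hHord : HasOrd (fun u => H.eval u⁻¹) 0 (-((M : ℤ) - if Even M then 1 else 0)) := by
    have h1 := hKord.mul (HasOrd.zpow 0 (-(M : ℤ)))
    rw [show -((M : ℤ) - if Even M then 1 else 0) = (if Even M then 1 else 0) + -(M : ℤ) by ring]
    refine h1.congr ?_
    filter_upwards [HasOrd.ne_eventually 0] with u hu
    rw [sub_zero] at hu ⊢
    have e1 : ∏ k, (if σ k then u⁻¹ + s k else 1) =
        (∏ k, if σ k then 1 + s k * u else 1) * u ^ (-(M : ℤ)) := by
      have : u ^ (-(M : ℤ)) = ∏ k, if σ k then u⁻¹ else 1 := by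
        rw [Finset.prod_ite]
        simp [hcard]
      rw [this, ← Finset.prod_mul_distrib]
      refine Finset.prod_congr rfl fun k _ => ?_
      split_ifs
      · field_simp
      · simp
    have e2 : ∏ k, (if σ k then 1 else u⁻¹ + s k) =
        (∏ k, if σ k then 1 else 1 + s k * u) * u ^ (-(M : ℤ)) := by
      have : u ^ (-(M : ℤ)) = ∏ k, if σ k then 1 else u⁻¹ := by
        rw [Finset.prod_ite]
        simp [hcard']
      rw [this, ← Finset.prod_mul_distrib]
      refine Finset.prod_congr rfl fun k _ => ?_
      split_ifs
      · simp
      · field_simp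
    rw [hHt, e1, e2]
    ring
  obtain ⟨hH0, hdeg⟩ := hHord.natDegree_eq
  -- the solution attached to a root of `H`
  have hroot : ∀ t, H.eval t = 0 → ∀ k, t + s k ≠ 0 := by
    intro t ht k hk
    rw [hHt, sub_eq_zero] at ht
    cases hσk : σ k
    · have h1 : ∏ k, (if σ k then 1 else t + s k) = 0 :=
        Finset.prod_eq_zero (Finset.mem_univ k) (by simp [hσk, hk])
      rw [h1, mul_zero, Finset.prod_eq_zero_iff] at ht
      obtain ⟨j, _, hj⟩ := ht
      split_ifs at hj with hσj
      · have := hinj (add_left_cancel (hk.trans hj.symm))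
        simp [this, hσj] at hσk
      · exact one_ne_zero hj
    · have h1 : ∏ k, (if σ k then t + s k else 1) = 0 :=
        Finset.prod_eq_zero (Finset.mem_univ k) (by simp [hσk, hk])
      rw [h1, eq_comm, mul_eq_zero, or_iff_right hε0, Finset.prod_eq_zero_iff] at ht
      obtain ⟨j, _, hj⟩ := ht
      split_ifs at hj with hσj
      · exact one_ne_zero hj
      · have := hinj (add_left_cancel (hk.trans hj.symm))
        simp [this, hσj] at hσk
  set Y : ℂ → Fin m → ℂ := fun t k => (signVec σ k * (t + s k)) ^ signVec σ k with hY
  have hYpow : ∀ t k, Y t k ^ signVec σ k = signVec σ k * (t + s k) := by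
    intro t k
    simp only [hY]
    unfold signVec
    split_ifs <;> simp
  have hYt : ∀ t k, signVec σ k * Y t k ^ signVec σ k = t + s k := by
    intro t k
    rw [hYpow, ← mul_assoc, signVec_mul_self, one_mul]
  have hY0 : ∀ t, (∀ k, t + s k ≠ 0) → ∀ k, Y t k ≠ 0 := fun t ht k =>
    zpow_ne_zero _ (mul_ne_zero (Int.cast_ne_zero.mpr (signVec_ne_zero σ k)) (ht k))
  have hYprod : ∀ t, (∀ k, t + s k ≠ 0) → (∏ k, Y t k = 1 ↔ H.eval t = 0) := by
    intro t ht
    have h1 : (∏ k, Y t k) * ∏ k, (if σ k then 1 else t + s k) =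
        ε * ∏ k, (if σ k then t + s k else 1) := by
      rw [← hprodε, ← Finset.prod_mul_distrib, ← Finset.prod_mul_distrib]
      refine Finset.prod_congr rfl fun k _ => ?_
      have := ht k
      simp only [hY]
      unfold signVec
      split_ifs
      · simp
      · push_cast
        rw [zpow_neg_one]
        field_simp
    have hne : ∏ k, (if σ k then 1 else t + s k) ≠ 0 :=
      Finset.prod_ne_zero_iff.mpr fun k _ => by split_ifs <;> simp [ht k]
    rw [hHt, sub_eq_zero]
    constructor
    · intro h
      rw [h, one_mul] at h1
      rw [h1, ← mul_assoc, hε2, one_mul]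
    · intro h
      rw [h, ← mul_assoc, hε2, one_mul] at h1
      exact mul_right_cancel₀ hne (by rw [h1, one_mul])
  have himage : {y : Fin m → ℂ | (∀ k, y k ≠ 0) ∧ ∏ k, y k = 1 ∧
      ∃ t, ∀ k, signVec σ k * y k ^ signVec σ k = t + s k} = Y '' H.roots.toFinset := by
    ext y
    simp only [Set.mem_ofPred_eq, Set.mem_image, Finset.mem_coe, Multiset.mem_toFinset,
      Polynomial.mem_roots hH0, Polynomial.IsRoot.def]
    constructor
    · rintro ⟨hy, hprod, t, ht⟩
      have hyY : Y t = y := by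
        funext k
        simp only [hY, ← ht k, ← mul_assoc, signVec_mul_self, one_mul]
        unfold signVec
        split_ifs <;> simp
      have hz : ∀ k, t + s k ≠ 0 := fun k => by
        rw [← ht k]
        exact mul_ne_zero (Int.cast_ne_zero.mpr (signVec_ne_zero σ k)) (zpow_ne_zero _ (hy k))
      exact ⟨t, (hYprod t hz).mp (by rw [hyY, hprod]), hyY⟩
    · rintro ⟨t, ht, rfl⟩
      exact ⟨hY0 t (hroot t ht), (hYprod t (hroot t ht)).mpr ht, t, hYt t⟩
  have hYinj : Set.InjOn Y H.roots.toFinset := by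
    intro t _ t' _ h
    have h1 := hYt t 0
    rw [h, hYt t' 0] at h1
    exact (add_right_cancel h1).symm
  have hsimple : ∀ t, H.eval t = 0 → H.rootMultiplicity t = 1 := by
    intro t ht
    have hz := hroot t ht
    have hlin' : ∀ k, HasDerivAt (fun u : ℂ => u + s k) 1 t := fun k =>
      (hasDerivAt_id t).add_const (s k)
    have hd : HasDerivAt (fun u => H.eval u)
        ((∏ k, if σ k then t + s k else 1) * (∑ k, if σ k then (t + s k)⁻¹ else 0) -
          ε * ((∏ k, if σ k then 1 else t + s k) * ∑ k, if σ k then 0 else (t + s k)⁻¹)) t := by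
      simp only [hHt]
      refine HasDerivAt.sub ?_ (HasDerivAt.const_mul ε ?_)
      · exact hasDerivAt_prod_of_log (f := fun k u => if σ k then u + s k else 1)
          (l := fun k => if σ k then (t + s k)⁻¹ else 0) fun k =>
            (hasDerivAt_ite (hlin' k) (hasDerivAt_const _ _)).congr_deriv (by
              split_ifs <;> simp [hz k])
      · exact hasDerivAt_prod_of_log (f := fun k u => if σ k then 1 else u + s k)
          (l := fun k => if σ k then 0 else (t + s k)⁻¹) fun k =>
            (hasDerivAt_ite (hasDerivAt_const _ _) (hlin' k)).congr_deriv (by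
              split_ifs <;> simp [hz k])
    have h1 := hreg (Y t) (hY0 t hz) ((hYprod t hz).mpr ht) ⟨t, hYt t⟩
    have h2 : ∏ k, (if σ k then t + s k else 1) ≠ 0 :=
      Finset.prod_ne_zero_iff.mpr fun k _ => by split_ifs <;> simp [hz k]
    have h3 : ∏ k, (if σ k then t + s k else 1) = ε * ∏ k, (if σ k then 1 else t + s k) := by
      rw [hHt, sub_eq_zero] at ht
      exact ht
    have h4 := HasOrd.of_hasDerivAt hd ht (by
      rw [← mul_assoc ε, ← h3, ← mul_sub, ← Finset.sum_sub_distrib]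
      refine mul_ne_zero h2 ?_
      convert h1 using 1
      refine Finset.sum_congr rfl fun k _ => ?_
      rw [hYpow]
      unfold signVec
      split_ifs
      · simp
      · simp [neg_add_rev, ← inv_neg, add_comm])
    exact_mod_cast h4.rootMultiplicity_eq
  rw [himage]
  refine ⟨(Finset.finite_toSet _).image _, ?_⟩
  rw [hYinj.ncard_image, Set.ncard_coe_finset, ← hdeg, ← IsAlgClosed.card_roots_eq_natDegree,
    ← Multiset.toFinset_sum_count_eq, Finset.card_eq_sum_ones]
  congr 1
  refine Finset.sum_congr rfl fun t ht => ?_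
  rw [Multiset.mem_toFinset, Polynomial.mem_roots hH0] at ht
  rw [Polynomial.count_roots, hsimple t ht]

end Degree

/-! ### Nonsingularity of the Kuramoto system -/

section Jacobian

variable {n : ℕ}

lemma differentiable_kuraX (k : ℕ) :
    Differentiable ℂ fun x : Fin n → ℂ => kuraX (n + 1) n.succ_pos x k :=
  kuraX_cases (P := fun f => Differentiable ℂ f) (differentiable_const 1)
    (fun j => by fun_prop) k

/-- The logarithmic derivative of `kuraX`. -/
def logDerivX (x v : Fin n → ℂ) (k : ℕ) : ℂ :=
  fderiv ℂ (fun x : Fin n → ℂ => kuraX (n + 1) n.succ_pos x k) x v /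
    kuraX (n + 1) n.succ_pos x k

lemma logDerivX_zero (x v : Fin n → ℂ) : logDerivX x v 0 = 0 := by
  simp [logDerivX, kuraX_zero]

lemma logDerivX_last (x v : Fin n → ℂ) : logDerivX x v (n + 1) = 0 := by
  simp [logDerivX, kuraX_last]

lemma logDerivX_succ (x v : Fin n → ℂ) (j : Fin n) : logDerivX x v (j + 1) = v j / x j := by
  have h : HasFDerivAt (fun x : Fin n → ℂ => x j)
      (ContinuousLinearMap.proj (R := ℂ) (φ := fun _ : Fin n => ℂ) j) x :=
    hasFDerivAt_apply j x
  simp [logDerivX, kuraX_succ, h.fderiv]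

lemma exists_hasFDerivAt_edge {x : Fin n → ℂ} (hx : ∀ j, x j ≠ 0) (k : Fin (n + 1)) :
    ∃ D : (Fin n → ℂ) →L[ℂ] ℂ, HasFDerivAt (fun x => edge x k - (edge x k)⁻¹) D x ∧
      ∀ v, D v = (edge x k + (edge x k)⁻¹) * (logDerivX x v k - logDerivX x v (k + 1)) := by
  have h0 := kuraX_ne_zero hx k
  have h1 := kuraX_ne_zero hx (k + 1)
  have d0 := (differentiable_kuraX (n := n) k x).hasFDerivAt
  have d1 := (differentiable_kuraX (n := n) (k + 1) x).hasFDerivAt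
  have e0 := (hasDerivAt_inv h0).comp_hasFDerivAt x d0
  have e1 := (hasDerivAt_inv h1).comp_hasFDerivAt x d1
  simp only [edge, inv_div]
  simp only [div_eq_mul_inv]
  refine ⟨_, (d0.mul e1).sub (d1.mul e0), fun v => ?_⟩
  simp only [logDerivX, sub_apply, add_apply, smul_apply, smul_eq_mul, Function.comp_apply]
  field_simp
  ring

lemma exists_kuraJac_mulVec (ω : Fin n → ℂ) (a : ℂ) {x : Fin n → ℂ} (hx : ∀ j, x j ≠ 0) :
    ∃ g : Fin (n + 1) → (Fin n → ℂ) → ℂ,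
      (∀ k v, g k v = (edge x k + (edge x k)⁻¹) * (logDerivX x v k - logDerivX x v (k + 1))) ∧
      ∀ i v, (kuraJac (n + 1) n.succ_pos ω a x).mulVec v i =
        -(a * (g i.succ v - g i.castSucc v)) := by
  choose D hD hDv using exists_hasFDerivAt_edge hx
  refine ⟨fun k v => D k v, hDv, fun i v => ?_⟩
  have h1 : HasFDerivAt (fun x => kuraF (n + 1) n.succ_pos ω a i x)
      (-(a • (D i.succ - D i.castSucc))) x := by
    simp only [kuraF_eq]
    exact ((((hD _).sub (hD _)).const_smul a).const_sub (ω i))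
  have h2 : ∀ j, deriv (fun t => kuraF (n + 1) n.succ_pos ω a i (Function.update x j t)) (x j) =
      -(a * (D i.succ (Pi.single j 1) - D i.castSucc (Pi.single j 1))) := by
    intro j
    have h3 := hasDerivAt_update x j (x j)
    have h4 : HasFDerivAt (fun x => kuraF (n + 1) n.succ_pos ω a i x)
      (-(a • (D i.succ - D i.castSucc))) (Function.update x j (x j)) := by
      rwa [Function.update_eq_self]
    refine (h4.comp_hasDerivAt (x j) h3).deriv.trans ?_
    simp
  have h5 : ∀ L : (Fin n → ℂ) →L[ℂ] ℂ, L v = ∑ j, L (Pi.single j 1) * v j := by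
    intro L
    conv_lhs => rw [← Finset.univ_sum_single v]
    rw [map_sum]
    refine Finset.sum_congr rfl fun j _ => ?_
    rw [show (Pi.single j (v j) : Fin n → ℂ) = v j • Pi.single j 1 by
      rw [← Pi.single_smul, smul_eq_mul, mul_one], map_smul, smul_eq_mul, mul_comm]
  simp only [Matrix.mulVec, dotProduct, kuraJac, Matrix.of_apply]
  rw [h5 (D i.succ), h5 (D i.castSucc), ← Finset.sum_sub_distrib, Finset.mul_sum,
    ← Finset.sum_neg_distrib]
  refine Finset.sum_congr rfl fun j _ => ?_
  refine (congrArg (· * v j) (h2 j)).trans ?_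
  ring

lemma isUnit_kuraJac (ω : Fin n → ℂ) {a : ℂ} (ha : a ≠ 0) {x : Fin n → ℂ} (hx : ∀ j, x j ≠ 0)
    (h : ∀ k, edge x k + (edge x k)⁻¹ ≠ 0) (hsum : ∑ k, (edge x k + (edge x k)⁻¹)⁻¹ ≠ 0) :
    IsUnit (kuraJac (n + 1) n.succ_pos ω a x) := by
  rw [← Matrix.mulVec_injective_iff_isUnit]
  refine (injective_iff_map_eq_zero (Matrix.mulVecLin (kuraJac (n + 1) n.succ_pos ω a x))).mpr
    fun v hv => ?_
  rw [Matrix.mulVecLin_apply] at hv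
  obtain ⟨g, hg, hJ⟩ := exists_kuraJac_mulVec ω a hx
  have hconst : ∀ k, g k v = g 0 v := by
    intro k
    induction k using Fin.induction with
    | zero => rfl
    | succ i ih =>
      have h1 := hJ i v
      rw [hv, Pi.zero_apply, eq_comm, neg_eq_zero, mul_eq_zero, or_iff_right ha,
        sub_eq_zero] at h1
      rw [h1, ih]
  have hd : ∀ k : Fin (n + 1), logDerivX x v k - logDerivX x v (k + 1) =
      g 0 v * (edge x k + (edge x k)⁻¹)⁻¹ := by
    intro k
    rw [← hconst k, hg, mul_right_comm, mul_inv_cancel₀ (h k), one_mul]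
  have htel : ∑ k : Fin (n + 1), (logDerivX x v k - logDerivX x v (k + 1)) = 0 := by
    rw [Fin.sum_univ_eq_sum_range (fun k => logDerivX x v k - logDerivX x v (k + 1)) (n + 1),
      Finset.sum_range_sub', logDerivX_zero, logDerivX_last, sub_zero]
  have hg0 : g 0 v = 0 := by
    simp only [hd] at htel
    rw [← Finset.mul_sum, mul_eq_zero, or_iff_left hsum] at htel
    exact htel
  have hzero : ∀ k, k ≤ n → logDerivX x v k = 0 := by
    intro k
    induction k with
    | zero => exact fun _ => logDerivX_zero x v
    | succ k ih =>
      intro hk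
      have h1 := hd ⟨k, by omega⟩
      rw [hg0, zero_mul, ih (by omega), zero_sub, neg_eq_zero] at h1
      exact h1
  funext j
  have h1 := hzero (j + 1) (by omega)
  rw [logDerivX_succ, div_eq_zero_iff, or_iff_left (hx j)] at h1
  exact h1

end Jacobian

/-! ### Generic parameters -/

section Generic

variable {n : ℕ}

lemma generically_regular : Generically n fun ω a => ∀ x : Fin n → ℂ, (∀ j, x j ≠ 0) →
    (∃ t, ∀ k, edge x k - (edge x k)⁻¹ = t + offset ω a k) →
    (∀ k, edge x k + (edge x k)⁻¹ ≠ 0) ∧ ∑ k, (edge x k + (edge x k)⁻¹)⁻¹ ≠ 0 := by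
  classical
  have hh : ∀ k, IsLaurent fun x : Fin n → ℂ => edge x k + (edge x k)⁻¹ := fun k =>
    (isLaurent_edge k).add (isLaurent_inv_edge k)
  have hg : ∀ k, IsLaurent fun x : Fin n → ℂ => edge x k - (edge x k)⁻¹ := fun k =>
    (isLaurent_edge k).sub (isLaurent_inv_edge k)
  refine (Generically.of_laurent
    (φ := fun (i : Fin n) x => (edge x i.succ - (edge x i.succ)⁻¹) -
      (edge x i.castSucc - (edge x i.castSucc)⁻¹))
    (J := fun x => (∏ k, (edge x k + (edge x k)⁻¹)) *
      ∑ k, ∏ j ∈ Finset.univ.erase k, (edge x j + (edge x j)⁻¹))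
    (fun i => (hg _).sub (hg _))
    ((IsLaurent.prod _ fun k _ => hh k).mul
      (IsLaurent.sum _ fun k _ => IsLaurent.prod _ fun j _ => hh j))
    (fun _ => 1) (fun _ => one_ne_zero) ?_).mono fun ω a ha h x hx ht => ?_
  · simp only [edge_one, inv_one, Finset.prod_const, Finset.sum_const, nsmul_eq_mul,
      Finset.card_erase_of_mem (Finset.mem_univ _), Finset.card_univ, Fintype.card_fin]
    norm_num
    exact_mod_cast n.succ_ne_zero
  · have h1 := h x hx
      ((forall_eq_mul_sub_iff ω ha fun k => edge x k - (edge x k)⁻¹).mpr ht)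
    have h2 := fun k => Finset.prod_ne_zero_iff.mp (left_ne_zero_of_mul h1) k (Finset.mem_univ k)
    refine ⟨h2, right_ne_zero_of_mul (a := ∏ k, (edge x k + (edge x k)⁻¹)) ?_⟩
    convert right_ne_zero_of_mul h1 using 1
    rw [Finset.mul_sum]
    refine Finset.sum_congr rfl fun k _ => ?_
    rw [← Finset.mul_prod_erase _ _ (Finset.mem_univ k), mul_right_comm,
      mul_inv_cancel₀ (h2 k), one_mul]

lemma isLaurent_edge_zpow_signVec (σ : Fin (n + 1) → Bool) (k : Fin (n + 1)) :
    IsLaurent fun x : Fin n → ℂ => edge x k ^ signVec σ k := by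
  unfold signVec
  split_ifs
  · simpa using isLaurent_edge k
  · simpa using isLaurent_inv_edge k

lemma isLaurent_inv_edge_zpow_signVec (σ : Fin (n + 1) → Bool) (k : Fin (n + 1)) :
    IsLaurent fun x : Fin n → ℂ => (edge x k ^ signVec σ k)⁻¹ := by
  unfold signVec
  split_ifs
  · simpa using isLaurent_inv_edge k
  · simpa using isLaurent_edge k

lemma generically_facet_regular (σ : Fin (n + 1) → Bool) :
    Generically n fun ω a => ∀ x : Fin n → ℂ, (∀ j, x j ≠ 0) →
      (∃ t, ∀ k, signVec σ k * edge x k ^ signVec σ k = t + offset ω a k) →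
      ∑ k, (edge x k ^ signVec σ k)⁻¹ ≠ 0 := by
  have hg : ∀ k, IsLaurent fun x : Fin n → ℂ => signVec σ k * edge x k ^ signVec σ k := fun k =>
    (IsLaurent.const _).mul (isLaurent_edge_zpow_signVec σ k)
  refine (Generically.of_laurent
    (φ := fun (i : Fin n) x => signVec σ i.succ * edge x i.succ ^ signVec σ i.succ -
      signVec σ i.castSucc * edge x i.castSucc ^ signVec σ i.castSucc)
    (J := fun x => ∑ k, (edge x k ^ signVec σ k)⁻¹)
    (fun i => (hg _).sub (hg _))
    (IsLaurent.sum _ fun k _ => isLaurent_inv_edge_zpow_signVec σ k)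
    (fun _ => 1) (fun _ => one_ne_zero) ?_).mono fun ω a ha h x hx ht => ?_
  · simp only [edge_one, one_zpow, inv_one, Finset.sum_const, nsmul_eq_mul, mul_one,
      Finset.card_univ, Fintype.card_fin]
    exact_mod_cast n.succ_ne_zero
  · exact h x hx
      ((forall_eq_mul_sub_iff ω ha fun k => signVec σ k * edge x k ^ signVec σ k).mpr ht)

lemma offset_eq (ω : Fin n → ℂ) (a : ℂ) (k : Fin (n + 1)) :
    offset ω a k = (∑ i : Fin n, (if i.castSucc < k then 1 else 0) * ω i) * a⁻¹ := by
  induction k using Fin.induction with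
  | zero => simp [offset]
  | succ j ih =>
    have h1 : offset ω a j.succ = offset ω a j.castSucc + ω j / a := by
      simp [offset, Fin.partialSum_succ]
    rw [h1, ih, div_eq_mul_inv, ← add_mul]
    congr 1
    have h2 : ω j = ∑ i, if i = j then ω i else 0 := by simp
    conv_lhs => rw [h2]
    rw [← Finset.sum_add_distrib]
    refine Finset.sum_congr rfl fun i _ => ?_
    have e1 : i.castSucc < j.castSucc ↔ i < j := Iff.rfl
    have e2 : i.castSucc < j.succ ↔ i ≤ j := Fin.castSucc_lt_succ_iff
    simp only [e1, e2]
    rcases lt_trichotomy i j with h | h | h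
    · simp [h, h.le, h.ne]
    · simp [h]
    · simp [h.not_gt, h.not_ge, h.ne']

/-- A linear form in the offsets with a nonzero partial sum of coefficients does not vanish for
generic parameters. -/
lemma generically_offset_ne_zero (c : Fin (n + 1) → ℂ) (i : Fin n)
    (hc : ∑ k, (if i.castSucc < k then c k else 0) ≠ 0) :
    Generically n fun ω a => ∑ k, c k * offset ω a k ≠ 0 := by
  refine (Generically.linear_ne_zero
    (fun i : Fin n => ∑ k, if i.castSucc < k then c k else 0)
    fun h => hc (congrFun h i)).mono fun ω a ha h => ?_
  convert mul_ne_zero h (inv_ne_zero ha) using 1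
  simp only [offset_eq, Finset.sum_mul, Finset.mul_sum]
  rw [Finset.sum_comm]
  refine Finset.sum_congr rfl fun i _ => Finset.sum_congr rfl fun k _ => ?_
  split_ifs <;> ring

lemma generically_offset_injective : Generically n fun ω a => Function.Injective (offset ω a) := by
  have key : ∀ jk : Fin (n + 1) × Fin (n + 1), Generically n fun ω a =>
      jk.1 < jk.2 → offset ω a jk.1 ≠ offset ω a jk.2 := by
    rintro ⟨j, k⟩
    refine Generically.of_imp fun hjk => ?_
    dsimp only at hjk ⊢
    have hj : (j : ℕ) < n := by have := k.is_lt; omega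
    refine (generically_offset_ne_zero
      (fun l => (if l = k then 1 else 0) - if l = j then 1 else 0) ⟨j, hj⟩ ?_).mono
      fun ω a _ h heq => h ?_
    · have : ∀ l : Fin (n + 1), (if (⟨j, hj⟩ : Fin n).castSucc < l then
          ((if l = k then 1 else 0) - if l = j then 1 else 0 : ℂ) else 0) =
          if l = k then 1 else 0 := by
        intro l
        have e : (⟨j, hj⟩ : Fin n).castSucc = j := rfl
        rw [e]
        rcases eq_or_ne l k with rfl | hlk
        · simp [hjk, hjk.ne']
        · rcases eq_or_ne l j with rfl | hlj
          · simp [hlk]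
          · simp [hlk, hlj]
      rw [Finset.sum_congr rfl fun l _ => this l]
      simp
    · simp [sub_mul, Finset.sum_sub_distrib, heq]
  refine (Generically.all key).mono fun ω a _ h j k hjk => ?_
  rcases lt_trichotomy j k with hlt | rfl | hlt
  · exact absurd hjk (h (j, k) hlt)
  · rfl
  · exact absurd hjk.symm (h (k, j) hlt)

lemma generically_sum_signVec_ne_zero (hn : 0 < n) (σ : Fin (n + 1) → Bool) :
    Generically n fun ω a => ∑ k, (signVec σ k : ℂ) * offset ω a k ≠ 0 := by
  refine generically_offset_ne_zero _ ⟨n - 1, by omega⟩ ?_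
  have : ∀ k : Fin (n + 1), (if (⟨n - 1, by omega⟩ : Fin n).castSucc < k then
      (signVec σ k : ℂ) else 0) = if k = Fin.last n then (signVec σ k : ℂ) else 0 := by
    intro k
    congr 1
    rw [Fin.lt_def, Fin.ext_iff, eq_iff_iff]
    simp only [Fin.val_castSucc, Fin.val_last]
    omega
  rw [Finset.sum_congr rfl fun k _ => this k]
  simp [signVec_ne_zero]

end Generic

/-! ### The main theorem -/

section Count

variable {n : ℕ}

lemma finite_and_ncard_eq_of_edge {P : (Fin (n + 1) → ℂ) → Prop}
    (h : {y : Fin (n + 1) → ℂ | (∀ k, y k ≠ 0) ∧ ∏ k, y k = 1 ∧ P y}.Finite) :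
    {x : Fin n → ℂ | (∀ j, x j ≠ 0) ∧ P (edge x)}.Finite ∧
    {x : Fin n → ℂ | (∀ j, x j ≠ 0) ∧ P (edge x)}.ncard =
      {y : Fin (n + 1) → ℂ | (∀ k, y k ≠ 0) ∧ ∏ k, y k = 1 ∧ P y}.ncard := by
  have hinj : Set.InjOn edge {x : Fin n → ℂ | (∀ j, x j ≠ 0) ∧ P (edge x)} :=
    edge_injOn.mono fun x hx => hx.1
  rw [← edge_image] at h ⊢
  exact ⟨h.of_finite_image hinj, hinj.ncard_image.symm⟩

/-- The count for parameters satisfying the genericity conditions. -/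
lemma ncard_kuraF_eq_sum_ncard_facetSol {M : ℕ} (hn : n + 1 = 2 * M) {ω : Fin n → ℂ} {a : ℂ}
    (ha : a ≠ 0) {R : Matrix (Fin n) (Fin n) ℂ} (hR : IsUnit R)
    (hreg : ∀ x : Fin n → ℂ, (∀ j, x j ≠ 0) →
      (∃ t, ∀ k, edge x k - (edge x k)⁻¹ = t + offset ω a k) →
      (∀ k, edge x k + (edge x k)⁻¹ ≠ 0) ∧ ∑ k, (edge x k + (edge x k)⁻¹)⁻¹ ≠ 0)
    (hfacet : ∀ (σ : Fin (n + 1) → Bool) (x : Fin n → ℂ), (∀ j, x j ≠ 0) →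
      (∃ t, ∀ k, signVec σ k * edge x k ^ signVec σ k = t + offset ω a k) →
      ∑ k, (edge x k ^ signVec σ k)⁻¹ ≠ 0)
    (hinj : Function.Injective (offset ω a))
    (hsum : ∀ σ : Fin (n + 1) → Bool, ∑ k, (signVec σ k : ℂ) * offset ω a k ≠ 0) :
    {x : Fin n → ℂ | (∀ j, x j ≠ 0) ∧ ∀ i, kuraF (n + 1) n.succ_pos ω a i x = 0}.Finite ∧
    (∀ σ ∈ Finset.univ.filter (fun σ : Fin (n + 1) → Bool => (∑ k, signVec σ k) = 0),
      (facetSol (n + 1) (R.mulVec ω) a R (signVec σ)).Finite) ∧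
    {x : Fin n → ℂ | (∀ j, x j ≠ 0) ∧ ∀ i, kuraF (n + 1) n.succ_pos ω a i x = 0}.ncard =
      ∑ σ ∈ Finset.univ.filter (fun σ : Fin (n + 1) → Bool => (∑ k, signVec σ k) = 0),
        (facetSol (n + 1) (R.mulVec ω) a R (signVec σ)).ncard := by
  obtain ⟨F, hF⟩ := exists_branch_polynomial (offset ω a)
  obtain ⟨hF0, hdeg⟩ := natDegree_branch_polynomial hn hF fun σ _ => hsum σ
  have hcount := ncard_branch_solutions hF0 hF fun y hy hprod ht => by
    obtain ⟨x, hx, rfl⟩ := exists_edge_eq hy hprod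
    exact hreg x hx ht
  obtain ⟨hfin, hcard⟩ := finite_and_ncard_eq_of_edge hcount.1
  have hfac : ∀ σ ∈ Finset.univ.filter
      (fun σ : Fin (n + 1) → Bool => (∑ k, signVec σ k) = 0),
      (facetSol (n + 1) (R.mulVec ω) a R (signVec σ)).Finite ∧
      ((facetSol (n + 1) (R.mulVec ω) a R (signVec σ)).ncard : ℤ) =
        M - if Even M then 1 else 0 := by
    intro σ hσ
    have h1 := ncard_facet_solutions hn (Finset.mem_filter.mp hσ).2 hinj (hsum σ)
      fun y hy hprod ht => by
        obtain ⟨x, hx, rfl⟩ := exists_edge_eq hy hprod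
        exact hfacet σ x hx ht
    obtain ⟨h2, h3⟩ := finite_and_ncard_eq_of_edge h1.1
    rw [facetSol_eq ω ha hR]
    exact ⟨h2, by rw [← h1.2, h3]⟩
  rw [kuraF_set_eq ω ha]
  refine ⟨hfin, fun σ hσ => (hfac σ hσ).1, ?_⟩
  rw [hcard, hcount.2]
  zify
  rw [hdeg]
  exact Finset.sum_congr rfl fun σ hσ => (hfac σ hσ).2.symm

end Count

end Auxiliary

/-- for even `N ≥ 4` and generic `(ω, a, R)` (with `a ≠ 0`, `R` invertible),
setting `c = Rω`, the number of solutions in `(ℂ∖{0})^n` of the algebraic Kuramoto system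
for `C_N` with uniform coupling equals the sum, over all sign vectors `λ ∈ {−1,1}^N` with
`λ_1 + ⋯ + λ_N = 0`, of the number of solutions of the facet subsystem determined by
`(c, a, R, V(λ))`; moreover all these solutions are isolated (the solution sets are finite)
and nonsingular (invertible Jacobian). -/
theorem kuramoto_count_eq_sum_facet_counts (N : ℕ) (hN : 4 ≤ N) (hEven : Even N) :
    ∃ p : MvPolynomial (Fin (N - 1) ⊕ Unit ⊕ (Fin (N - 1) × Fin (N - 1))) ℂ, p ≠ 0 ∧
      ∀ (ω : Fin (N - 1) → ℂ) (a : ℂ) (R : Matrix (Fin (N - 1)) (Fin (N - 1)) ℂ),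
        a ≠ 0 → IsUnit R →
        MvPolynomial.eval
            (Sum.elim ω (Sum.elim (fun _ => a) (fun ij => R ij.1 ij.2))) p ≠ 0 →
        ({x : Fin (N - 1) → ℂ | (∀ j, x j ≠ 0) ∧
            ∀ i, kuraF N (by omega) ω a i x = 0} : Set (Fin (N - 1) → ℂ)).Finite ∧
        (∀ s ∈ Finset.univ.filter (fun s : Fin N → Bool => (∑ k, signVec s k) = 0),
          (facetSol N (R.mulVec ω) a R (signVec s)).Finite) ∧
        ({x : Fin (N - 1) → ℂ | (∀ j, x j ≠ 0) ∧
            ∀ i, kuraF N (by omega) ω a i x = 0} : Set (Fin (N - 1) → ℂ)).ncard =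
          ∑ s ∈ Finset.univ.filter (fun s : Fin N → Bool => (∑ k, signVec s k) = 0),
            (facetSol N (R.mulVec ω) a R (signVec s)).ncard ∧
        ∀ x : Fin (N - 1) → ℂ, (∀ j, x j ≠ 0) → (∀ i, kuraF N (by omega) ω a i x = 0) →
          IsUnit (kuraJac N (by omega) ω a x) := by
  obtain ⟨n, rfl⟩ : ∃ n, N = n + 1 := ⟨N - 1, by omega⟩
  obtain ⟨M, hM⟩ := hEven
  rw [← two_mul] at hM
  obtain ⟨q, hq, hgen⟩ := ((generically_regular (n := n)).and
    (Generically.all generically_facet_regular)).and (generically_offset_injective.and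
      (Generically.all (generically_sum_signVec_ne_zero (by omega))))
  have hinj : Function.Injective
      (Sum.map id Sum.inl : Fin n ⊕ Unit → Fin n ⊕ Unit ⊕ (Fin n × Fin n)) :=
    Function.injective_id.sumMap Sum.inl_injective
  refine ⟨MvPolynomial.rename (Sum.map id Sum.inl) q, fun h => hq
    (MvPolynomial.rename_injective _ hinj (h.trans (map_zero _).symm)),
    fun ω a R ha hR hp => ?_⟩
  rw [MvPolynomial.eval_rename, Sum.elim_comp_map] at hp
  obtain ⟨⟨hreg, hfacet⟩, hoff, hsum⟩ := hgen ω a ha hp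
  obtain ⟨h1, h2, h3⟩ := ncard_kuraF_eq_sum_ncard_facetSol hM ha hR hreg hfacet hoff hsum
  refine ⟨h1, h2, h3, fun x hx hsol => ?_⟩
  have hmem : x ∈ {x : Fin n → ℂ | (∀ j, x j ≠ 0) ∧
      ∀ i, kuraF (n + 1) n.succ_pos ω a i x = 0} := ⟨hx, hsol⟩
  rw [kuraF_set_eq (n := n) ω ha] at hmem
  obtain ⟨h4, h5⟩ := hreg x hx hmem.2
  exact isUnit_kuraJac ω ha hx h4 h5
end
end

section
/- Let N ≥ 4 be even and let λ, λ′ ∈ {−1,1}^N both satisfy λ_1 + ⋯ + λ_N = 0 and λ′_1 + ⋯ + λ′_N = 0. Then there exist an (N−1)×(N−1) integer matrix U with det U ∈ {1,−1} and an N×N permutation matrix P such that U·V(λ)·P = V(λ′). -/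
noncomputable section

/-- The matrix of the forward difference operator `x ↦ (x (r + 1) - x r)_r`. -/
def forwardDiff (n : ℕ) : Matrix (Fin n) (Fin (n + 1)) ℤ :=
  Matrix.of fun r k => (if r.succ = k then 1 else 0) - (if r.castSucc = k then 1 else 0)

/-- The matrix of the summation operator, a right inverse of `forwardDiff`. -/
def partialSum (n : ℕ) : Matrix (Fin (n + 1)) (Fin n) ℤ :=
  Matrix.of fun k r => if (r : ℕ) < k then 1 else 0

theorem facetV_succ (n : ℕ) (lam : Fin (n + 1) → ℤ) (r : Fin n) (k : Fin (n + 1)) :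
    facetV (n + 1) lam r k = lam k * forwardDiff n r k := by
  simp [facetV, forwardDiff, Fin.ext_iff]

theorem forwardDiff_mul_apply {n : ℕ} {m : Type*} (M : Matrix (Fin (n + 1)) m ℤ)
    (r : Fin n) (j : m) :
    (forwardDiff n * M) r j = M r.succ j - M r.castSucc j := by
  simp [Matrix.mul_apply, forwardDiff, sub_mul, Finset.sum_sub_distrib]

theorem sum_forwardDiff (n : ℕ) (r : Fin n) : ∑ k, forwardDiff n r k = 0 := by
  simp [forwardDiff, Finset.sum_sub_distrib]

theorem forwardDiff_mul_partialSum (n : ℕ) : forwardDiff n * partialSum n = 1 := by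
  ext r s
  simp only [forwardDiff_mul_apply, partialSum, Matrix.of_apply, Matrix.one_apply, Fin.ext_iff,
    Fin.val_succ, Fin.val_castSucc]
  split_ifs <;> omega

/-- `partialSum * forwardDiff` differs from the identity by a matrix with constant columns. -/
theorem exists_partialSum_mul_forwardDiff (n : ℕ) : ∃ c : Fin (n + 1) → ℤ,
    partialSum n * forwardDiff n = 1 + Matrix.of fun _ j => c j := by
  set E := partialSum n * forwardDiff n - 1 with hE
  have hDE : forwardDiff n * E = 0 := by
    rw [hE, Matrix.mul_sub, ← Matrix.mul_assoc, forwardDiff_mul_partialSum, Matrix.one_mul,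
      Matrix.mul_one, sub_self]
  refine ⟨E 0, ?_⟩
  have hconst : E = Matrix.of fun _ j => E 0 j := by
    ext k j
    rw [Matrix.of_apply]
    induction k using Fin.induction with
    | zero => rfl
    | succ r ih =>
      have h := forwardDiff_mul_apply E r j
      rw [hDE, Matrix.zero_apply] at h
      linarith
  rw [← hconst, hE, add_sub_cancel]

/-- The integer matrix permuting the columns of `forwardDiff` according to `ρ`. -/
def columnAction {n : ℕ} (ρ : Equiv.Perm (Fin (n + 1))) : Matrix (Fin n) (Fin n) ℤ :=
  (forwardDiff n).submatrix id ρ * partialSum n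

theorem columnAction_mul_forwardDiff {n : ℕ} (ρ : Equiv.Perm (Fin (n + 1))) :
    columnAction ρ * forwardDiff n = (forwardDiff n).submatrix id ρ := by
  obtain ⟨c, hc⟩ := exists_partialSum_mul_forwardDiff n
  rw [columnAction, Matrix.mul_assoc, hc, Matrix.mul_add, Matrix.mul_one, add_eq_left]
  ext r j
  simp only [Matrix.mul_apply, Matrix.submatrix_apply, id, Matrix.of_apply, Matrix.zero_apply]
  rw [← Finset.sum_mul, Equiv.sum_comp ρ (forwardDiff n r), sum_forwardDiff, zero_mul]

theorem columnAction_mul_symm {n : ℕ} (ρ : Equiv.Perm (Fin (n + 1))) :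
    columnAction ρ * columnAction ρ.symm = 1 := by
  have h : columnAction ρ * (forwardDiff n).submatrix id ρ.symm = forwardDiff n := by
    ext r k
    have h := congrFun (congrFun (columnAction_mul_forwardDiff ρ) r) (ρ.symm k)
    simpa [Matrix.mul_apply] using h
  rw [columnAction.eq_1 ρ.symm, ← Matrix.mul_assoc, h, forwardDiff_mul_partialSum]

theorem isUnit_det_columnAction {n : ℕ} (ρ : Equiv.Perm (Fin (n + 1))) :
    IsUnit (columnAction ρ).det :=
  IsUnit.of_mul_eq_one (columnAction ρ.symm).det <| by
    rw [← Matrix.det_mul, columnAction_mul_symm, Matrix.det_one]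

/-- Sign vectors with the same sum are rearrangements of each other. -/
theorem exists_perm_of_sum_eq {ι : Type*} [Fintype ι] (f g : ι → ℤ)
    (hf : ∀ k, f k = 1 ∨ f k = -1) (hg : ∀ k, g k = 1 ∨ g k = -1)
    (hfg : ∑ k, f k = ∑ k, g k) : ∃ τ : Equiv.Perm ι, ∀ k, f (τ k) = g k := by
  classical
  have hpos (h : ι → ℤ) (hh : ∀ k, h k = 1 ∨ h k = -1) :
      2 * (Fintype.card {k // h k = 1} : ℤ) = Fintype.card ι + ∑ k, h k := by
    rw [Fintype.card_subtype, Finset.card_filter, Fintype.card_eq_sum_ones]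
    push_cast
    rw [Finset.mul_sum, ← Finset.sum_add_distrib]
    refine Finset.sum_congr rfl fun k _ => ?_
    rcases hh k with h1 | h1 <;> simp [h1]
  have hneg (h : ι → ℤ) (hh : ∀ k, h k = 1 ∨ h k = -1) :
      2 * (Fintype.card {k // h k = -1} : ℤ) = Fintype.card ι - ∑ k, h k := by
    rw [Fintype.card_subtype, Finset.card_filter, Fintype.card_eq_sum_ones]
    push_cast
    rw [Finset.mul_sum, ← Finset.sum_sub_distrib]
    refine Finset.sum_congr rfl fun k _ => ?_
    rcases hh k with h1 | h1 <;> simp [h1]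
  have hcard (c : ℤ) : Fintype.card {k // g k = c} = Fintype.card {k // f k = c} := by
    by_cases h1 : c = 1
    · subst h1
      have := hpos f hf
      have := hpos g hg
      omega
    by_cases h2 : c = -1
    · subst h2
      have := hneg f hf
      have := hneg g hg
      omega
    have hempty (h : ι → ℤ) (hh : ∀ k, h k = 1 ∨ h k = -1) : IsEmpty {k // h k = c} :=
      ⟨fun ⟨k, hk⟩ => by rcases hh k with h' | h' <;> omega⟩
    have := hempty f hf
    have := hempty g hg
    simp only [Fintype.card_eq_zero]
  exact ⟨Equiv.ofFiberEquiv fun c => Fintype.equivOfCardEq (hcard c),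
    fun k => Equiv.ofFiberEquiv_map _ k⟩

/-- for even `N ≥ 4` and balanced sign vectors `λ, λ' ∈ {−1,1}^N`, there exist
a unimodular integer matrix `U` and a permutation matrix `P` with `U·V(λ)·P = V(λ')`. -/
theorem facets_unimodularly_equivalent (N : ℕ) (hN : 4 ≤ N) (hEven : Even N)
    (lam lam' : Fin N → ℤ)
    (hlam : ∀ k, lam k = 1 ∨ lam k = -1) (hlam' : ∀ k, lam' k = 1 ∨ lam' k = -1)
    (hsum : ∑ k, lam k = 0) (hsum' : ∑ k, lam' k = 0) :
    ∃ (U : Matrix (Fin (N - 1)) (Fin (N - 1)) ℤ) (σ : Equiv.Perm (Fin N)),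
      (U.det = 1 ∨ U.det = -1) ∧
      U * facetV N lam * σ.permMatrix ℤ = facetV N lam' := by
  obtain ⟨n, rfl⟩ : ∃ n, N = n + 1 := ⟨N - 1, by omega⟩
  obtain ⟨τ, hτ⟩ := exists_perm_of_sum_eq lam lam' hlam hlam' (hsum.trans hsum'.symm)
  refine ⟨columnAction τ.symm, τ.symm, Int.isUnit_iff.mp (isUnit_det_columnAction τ.symm), ?_⟩
  rw [Equiv.Perm.permMatrix, PEquiv.mul_toMatrix_toPEquiv]
  ext r k
  have h := congrFun (congrFun (columnAction_mul_forwardDiff τ.symm) r) (τ k)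
  rw [Matrix.submatrix_apply, Equiv.symm_apply_apply, id, Matrix.mul_apply] at h
  change ∑ s : Fin n, columnAction τ.symm r s * facetV (n + 1) lam s (τ k) = _
  simp only [facetV_succ]
  rw [← h, Finset.mul_sum, hτ]
  exact Finset.sum_congr rfl fun s _ => mul_left_comm _ _ _
end
end

section
/- Let n ≥ 1 and let h ∈ {−1,1}^n satisfy h_1 + ⋯ + h_n = 1 and h_1·h_2·⋯·h_n = −1. Then the set of solutions y ∈ (ℂ∖{0})^n of the system y_i + h_i·∏_{j=1}^n y_j^{h_j} = 0 for i = 1,…,n, is exactly { (μ·h_1, …, μ·h_n) : μ ∈ ℂ∖{0} }; in particular it is nonempty and forms a single one-parameter family. -/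
noncomputable section

/-- if `h ∈ {−1,1}^n` with `∑ h_i = 1` and `∏ h_i = −1`, then the solutions
`y ∈ (ℂ∖{0})^n` of the system `y_i + h_i·∏_j y_j^{h_j} = 0` (`i = 1, …, n`) are exactly
the nonzero scalar multiples of `h`. -/
theorem initial_system_solutions_line (n : ℕ) (hn : 1 ≤ n)
    (h : Fin n → ℤ) (hpm : ∀ i, h i = 1 ∨ h i = -1)
    (hsum : ∑ i, h i = 1) (hprod : ∏ i, h i = -1) :
    {y : Fin n → ℂ | (∀ j, y j ≠ 0) ∧
        ∀ i, y i + (h i : ℂ) * ∏ j, y j ^ h j = 0} =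
      {y : Fin n → ℂ | ∃ μ : ℂ, μ ≠ 0 ∧ y = fun i => μ * (h i : ℂ)} := by
  have key (μ : ℂ) (hμ : μ ≠ 0) : ∏ j, (μ * (h j : ℂ)) ^ h j = -μ := by
    have hself (j : Fin n) : (h j : ℂ) ^ h j = (h j : ℂ) := by
      rcases hpm j with hj | hj <;> simp [hj]
    simp_rw [mul_zpow, hself]
    rw [Finset.prod_mul_distrib, ← Int.cast_prod, hprod]
    have hpow (s : Finset (Fin n)) : ∏ j ∈ s, μ ^ h j = μ ^ ∑ j ∈ s, h j := by
      induction s using Finset.cons_induction with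
      | empty => simp
      | cons a s ha ih => rw [Finset.prod_cons, Finset.sum_cons, zpow_add₀ hμ, ih]
    rw [hpow, hsum]
    simp
  ext y
  constructor
  · rintro ⟨hy, heq⟩
    refine ⟨-∏ j, y j ^ h j,
      neg_ne_zero.mpr (Finset.prod_ne_zero_iff.mpr fun j _ => zpow_ne_zero _ (hy j)), ?_⟩
    funext i
    linear_combination heq i
  · rintro ⟨μ, hμ, rfl⟩
    refine ⟨fun j => ?_, fun i => ?_⟩
    · rcases hpm j with hj | hj <;> simp [hj, hμ]
    · rw [key μ hμ]
      ring
end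
end
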